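/- Let d ≥ 1, 1/2 ≤ s < 1, and let f : [−1,1] → ℝ be C^{1,α} with α > 0. Let u be a stable solution of (−Δ)^s u = f(u) in ℝ^d with |u| ≤ 1, and let M₀ ≥ 2 be an upper bound for the L^∞ norm of f on [−1,1]. Then there is a constant C₂ = C₂(d,s,f) such that for every x₀ ∈ ℝ^d and every R ≥ 1: ∫_{B_R(x₀)} |∇u(x)| dx ≤ C₂ · R^{d+2s−2} · log(M₀ R). -/

import Mathlib

open MeasureTheory Metric Set
open scoped ENNReal NNReal

/-- The fractional `s`-energy `J^s(u,Ω)` of `u : ℝ^d → ℝ` on an open set `Ω`: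
`J^s(u,Ω) = ∬_{(ℝ^d×ℝ^d)∖(Ωᶜ×Ωᶜ)} |u(x)−u(y)|²/|x−y|^{d+2s} dy dx`, valued in `[0,∞]`. -/
noncomputable def Js (d : ℕ) (s : ℝ) (u : EuclideanSpace ℝ (Fin d) → ℝ)
    (Ω : Set (EuclideanSpace ℝ (Fin d))) : ℝ≥0∞ :=
  ∫⁻ p : EuclideanSpace ℝ (Fin d) × EuclideanSpace ℝ (Fin d) in (Ωᶜ ×ˢ Ωᶜ)ᶜ,
    ENNReal.ofReal ((u p.1 - u p.2)^2 / ‖p.1 - p.2‖ ^ ((d : ℝ) + 2*s))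

/-- The normalizing constant `C(d,s) = 2^{2s} Γ(d/2+s) / (π^{d/2} |Γ(−s)|)` of the fractional
Laplacian, which normalizes its Fourier symbol to `|ξ|^{2s}`. -/
noncomputable def fracC (d : ℕ) (s : ℝ) : ℝ :=
  2 ^ (2*s) * Real.Gamma ((d : ℝ)/2 + s) / (Real.pi ^ ((d : ℝ)/2) * |Real.Gamma (-s)|)

/-- `f : [−1,1] → ℝ` is `C^{1,α}`: it has derivative `f'` on `[−1,1]` and `f'` is
`α`-Hölder continuous on `[−1,1]`. -/
def IsC1Alpha (f f' : ℝ → ℝ) (α : ℝ) : Prop :=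
  (∀ x ∈ Set.Icc (-1 : ℝ) 1, HasDerivAt f (f' x) x) ∧
  ∃ Cα : ℝ, 0 ≤ Cα ∧ ∀ x ∈ Set.Icc (-1 : ℝ) 1, ∀ y ∈ Set.Icc (-1 : ℝ) 1,
    |f' x - f' y| ≤ Cα * |x - y| ^ α

/-- `u ∈ C²(ℝ^d)` with `|u| ≤ 1` is a stable solution of `(−Δ)^s u = f(u)` in `ℝ^d`:
the equation `(C(d,s)/2)∫ (2u(x)−u(x+y)−u(x−y))/|y|^{d+2s} dy = f(u(x))` holds pointwise and
for every `η ∈ C_c^∞(ℝ^d)` one has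
`(C(d,s)/2) ∬ |η(x)−η(y)|²/|x−y|^{d+2s} dx dy ≥ ∫ f'(u(x)) η(x)² dx`. -/
def IsStableSolution (d : ℕ) (s : ℝ) (f f' : ℝ → ℝ)
    (u : EuclideanSpace ℝ (Fin d) → ℝ) : Prop :=
  ContDiff ℝ 2 u ∧ (∀ x, |u x| ≤ 1) ∧
  (∀ x : EuclideanSpace ℝ (Fin d),
    fracC d s / 2 * ∫ y : EuclideanSpace ℝ (Fin d),
      (2 * u x - u (x + y) - u (x - y)) / ‖y‖ ^ ((d : ℝ) + 2*s) = f (u x)) ∧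
  (∀ η : EuclideanSpace ℝ (Fin d) → ℝ, ContDiff ℝ (⊤ : ℕ∞) η → HasCompactSupport η →
    ∫ x : EuclideanSpace ℝ (Fin d), f' (u x) * (η x)^2 ≤
      fracC d s / 2 * ∫ x : EuclideanSpace ℝ (Fin d), ∫ y : EuclideanSpace ℝ (Fin d),
        (η x - η y)^2 / ‖x - y‖ ^ ((d : ℝ) + 2*s))

abbrev Eu (d : ℕ) := EuclideanSpace ℝ (Fin d)

lemma eu_nontrivial {d : ℕ} (hd : 1 ≤ d) : Nontrivial (Eu d) := by
  have : Nonempty (Fin d) := ⟨⟨0, hd⟩⟩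
  infer_instance

/-- radial integrability criterion -/
lemma radial_pow_small {d : ℕ} (hd : 1 ≤ d) (q : ℝ) (hq : -(d:ℝ) < q) (r : ℝ) (hr : 0 < r) :
    Integrable (fun z : Eu d => if ‖z‖ < r then ‖z‖ ^ q else 0) ∧
    (∫ z : Eu d, if ‖z‖ < r then ‖z‖ ^ q else 0) =
      d * volume.real (ball (0 : Eu d) 1) * (r ^ (q + d) / (q + d)) := by
  have := eu_nontrivial hd
  have key : ∀ y ∈ Ioi (0:ℝ), y ^ (Module.finrank ℝ (Eu d) - 1) • (if y < r then y ^ q else 0) =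
      (Ioo (0:ℝ) r).indicator (fun y => y ^ (q + d - 1)) y := by
    intro y hy
    have hy' : (0:ℝ) < y := hy
    by_cases h : y < r
    · have : y ∈ Ioo (0:ℝ) r := ⟨hy, h⟩
      simp only [h, if_true, this, indicator_of_mem, finrank_euclideanSpace, Fintype.card_fin, smul_eq_mul]
      rw [← Real.rpow_natCast, ← Real.rpow_add hy', Nat.cast_sub hd]
      congr 1; push_cast; ring
    · have : y ∉ Ioo (0:ℝ) r := fun hh => h hh.2
      simp [h]
  have hint : IntegrableOn (fun y : ℝ => y ^ (q + d - 1)) (Ioo 0 r) :=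
    (intervalIntegral.integrableOn_Ioo_rpow_iff hr).2 (by linarith)
  constructor
  · rw [integrable_fun_norm_addHaar (μ := volume) (E := Eu d) (f := fun y : ℝ => if y < r then y ^ q else 0)]
    rw [integrableOn_congr_fun key measurableSet_Ioi]
    exact (integrable_indicator_iff measurableSet_Ioo).2 hint |>.integrableOn
  · rw [integral_fun_norm_addHaar (μ := volume) (E := Eu d) (f := fun y : ℝ => if y < r then y ^ q else 0)]
    rw [setIntegral_congr_fun measurableSet_Ioi key, setIntegral_indicator measurableSet_Ioo]
    have : Ioi (0:ℝ) ∩ Ioo 0 r = Ioo 0 r := by ext; simp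
    rw [this, ← integral_Ioc_eq_integral_Ioo, ← intervalIntegral.integral_of_le hr.le,
      integral_rpow (Or.inl (by linarith))]
    simp only [finrank_euclideanSpace, Fintype.card_fin, smul_eq_mul, nsmul_eq_mul]
    rw [show q + d - 1 + 1 = q + d by ring, Real.zero_rpow (by linarith)]
    ring

lemma radial_pow_large {d : ℕ} (hd : 1 ≤ d) (q : ℝ) (hq : q < -(d:ℝ)) (r : ℝ) (hr : 0 < r) :
    Integrable (fun z : Eu d => if r < ‖z‖ then ‖z‖ ^ q else 0) ∧
    (∫ z : Eu d, if r < ‖z‖ then ‖z‖ ^ q else 0) =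
      d * volume.real (ball (0 : Eu d) 1) * (r ^ (q + d) / (-(q + d))) := by
  have := eu_nontrivial hd
  have key : ∀ y ∈ Ioi (0:ℝ), y ^ (Module.finrank ℝ (Eu d) - 1) • (if r < y then y ^ q else 0) =
      (Ioi r).indicator (fun y => y ^ (q + d - 1)) y := by
    intro y hy
    have hy' : (0:ℝ) < y := hy
    by_cases h : r < y
    · have : y ∈ Ioi r := h
      simp only [h, if_true, this, indicator_of_mem, finrank_euclideanSpace, Fintype.card_fin, smul_eq_mul]
      rw [← Real.rpow_natCast, ← Real.rpow_add hy', Nat.cast_sub hd]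
      congr 1; push_cast; ring
    · have : y ∉ Ioi r := h
      simp [h]
  have hint : IntegrableOn (fun y : ℝ => y ^ (q + d - 1)) (Ioi r) :=
    integrableOn_Ioi_rpow_of_lt (by linarith) hr
  constructor
  · rw [integrable_fun_norm_addHaar (μ := volume) (E := Eu d) (f := fun y : ℝ => if r < y then y ^ q else 0)]
    rw [integrableOn_congr_fun key measurableSet_Ioi]
    exact (integrable_indicator_iff measurableSet_Ioi).2 hint |>.integrableOn
  · rw [integral_fun_norm_addHaar (μ := volume) (E := Eu d) (f := fun y : ℝ => if r < y then y ^ q else 0)]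
    rw [setIntegral_congr_fun measurableSet_Ioi key, setIntegral_indicator measurableSet_Ioi]
    have : Ioi (0:ℝ) ∩ Ioi r = Ioi r := by
      ext x; simp only [mem_inter_iff, mem_Ioi]; exact ⟨fun h => h.2, fun h => ⟨hr.trans h, h⟩⟩
    rw [this, integral_Ioi_rpow_of_lt (by linarith) hr]
    simp only [finrank_euclideanSpace, Fintype.card_fin, smul_eq_mul, nsmul_eq_mul]
    rw [show q + d - 1 + 1 = q + d by ring]
    rw [div_neg, neg_div]; ring

lemma radial_log {d : ℕ} (hd : 1 ≤ d) (R : ℝ) (hR : 1 ≤ R) :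
    Integrable (fun z : Eu d => if 1 ≤ ‖z‖ ∧ ‖z‖ ≤ R then ‖z‖ ^ (-(d:ℝ)) else 0) ∧
    (∫ z : Eu d, if 1 ≤ ‖z‖ ∧ ‖z‖ ≤ R then ‖z‖ ^ (-(d:ℝ)) else 0) =
      d * volume.real (ball (0 : Eu d) 1) * Real.log R := by
  have := eu_nontrivial hd
  have key : ∀ y ∈ Ioi (0:ℝ), y ^ (Module.finrank ℝ (Eu d) - 1) • (if 1 ≤ y ∧ y ≤ R then y ^ (-(d:ℝ)) else 0) =
      (Icc 1 R).indicator (fun y => y⁻¹) y := by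
    intro y hy
    have hy' : (0:ℝ) < y := hy
    by_cases h : 1 ≤ y ∧ y ≤ R
    · have : y ∈ Icc 1 R := h
      simp only [h, if_true, this, indicator_of_mem, finrank_euclideanSpace, Fintype.card_fin, smul_eq_mul, and_self]
      rw [← Real.rpow_natCast, ← Real.rpow_add hy', Nat.cast_sub hd, ← Real.rpow_neg_one]
      congr 1; push_cast; ring
    · have : y ∉ Icc 1 R := h
      rw [indicator_of_notMem this]
      simp [h]
  have hint : IntegrableOn (fun y : ℝ => y⁻¹) (Icc 1 R) := by
    apply ContinuousOn.integrableOn_Icc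
    exact continuousOn_inv₀.mono (fun x hx => by simp; have := hx.1; linarith)
  constructor
  · rw [integrable_fun_norm_addHaar (μ := volume) (E := Eu d) (f := fun y : ℝ => if 1 ≤ y ∧ y ≤ R then y ^ (-(d:ℝ)) else 0)]
    rw [integrableOn_congr_fun key measurableSet_Ioi]
    exact (integrable_indicator_iff measurableSet_Icc).2 hint |>.integrableOn
  · rw [integral_fun_norm_addHaar (μ := volume) (E := Eu d) (f := fun y : ℝ => if 1 ≤ y ∧ y ≤ R then y ^ (-(d:ℝ)) else 0)]
    rw [setIntegral_congr_fun measurableSet_Ioi key, setIntegral_indicator measurableSet_Icc]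
    have : Ioi (0:ℝ) ∩ Icc 1 R = Icc 1 R := by
      ext x; simp only [mem_inter_iff, mem_Ioi, mem_Icc]
      exact ⟨fun h => h.2, fun h => ⟨by linarith [h.1], h⟩⟩
    rw [this, integral_Icc_eq_integral_Ioc, ← intervalIntegral.integral_of_le hR, integral_inv_of_pos (by norm_num) (by linarith)]
    simp [finrank_euclideanSpace, Fintype.card_fin, smul_eq_mul, nsmul_eq_mul]
    ring

/-- the truncated kernel -/
noncomputable def tker (d : ℕ) (s : ℝ) (z : Eu d) : ℝ := min (‖z‖ ^ 2) 1 * (‖z‖ ^ ((d : ℝ) + 2*s))⁻¹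

lemma tker_nonneg (d : ℕ) (s : ℝ) (z : Eu d) : 0 ≤ tker d s z := by
  unfold tker; positivity

lemma tker_neg (d : ℕ) (s : ℝ) (z : Eu d) : tker d s (-z) = tker d s z := by
  unfold tker; simp

lemma kinv_meas (d : ℕ) (s : ℝ) : Measurable (fun z : Eu d => (‖z‖ ^ ((d : ℝ) + 2*s))⁻¹) := by
  fun_prop

lemma tker_integrable {d : ℕ} (hd : 1 ≤ d) {s : ℝ} (hs0 : 1/2 ≤ s) (hs1 : s < 1) :
    Integrable (tker d s) := by
  have h1 := (radial_pow_small hd (2 - ((d:ℝ) + 2*s)) (by linarith) 2 (by norm_num)).1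
  have h2 := (radial_pow_large hd (-((d:ℝ) + 2*s)) (by linarith) 1 (by norm_num)).1
  refine (h1.add h2).mono' ?_ (Filter.Eventually.of_forall fun z => ?_)
  · unfold tker
    exact (by fun_prop : Measurable _).aestronglyMeasurable
  · rw [Real.norm_of_nonneg (tker_nonneg d s z)]
    simp only [Pi.add_apply, tker]
    have hA : 0 ≤ (if ‖z‖ < 2 then ‖z‖ ^ (2 - ((d:ℝ) + 2*s)) else 0) := by positivity
    have hB : 0 ≤ (if 1 < ‖z‖ then ‖z‖ ^ (-((d:ℝ) + 2*s)) else 0) := by positivity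
    by_cases h : 1 < ‖z‖
    · have : (if 1 < ‖z‖ then ‖z‖ ^ (-((d:ℝ) + 2*s)) else 0) = (‖z‖ ^ ((d : ℝ) + 2*s))⁻¹ := by
        rw [if_pos h, Real.rpow_neg (norm_nonneg _)]
      rw [this] at hB ⊢
      have : min (‖z‖ ^ 2) 1 * (‖z‖ ^ ((d : ℝ) + 2*s))⁻¹ ≤ 1 * (‖z‖ ^ ((d : ℝ) + 2*s))⁻¹ :=
        mul_le_mul_of_nonneg_right (min_le_right _ _) hB
      linarith
    · by_cases hz : z = 0
      · subst hz; simp only [norm_zero]; simp; positivity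
      · have hz' : 0 < ‖z‖ := norm_pos_iff.2 hz
        have h2 : ‖z‖ < 2 := by linarith
        rw [if_pos h2] at hA ⊢
        have e : ‖z‖ ^ (2 - ((d:ℝ) + 2*s)) = ‖z‖^2 * (‖z‖ ^ ((d : ℝ) + 2*s))⁻¹ := by
          rw [Real.rpow_sub hz', div_eq_mul_inv]; norm_num
        rw [e]
        have : min (‖z‖ ^ 2) 1 * (‖z‖ ^ ((d : ℝ) + 2*s))⁻¹ ≤ ‖z‖^2 * (‖z‖ ^ ((d : ℝ) + 2*s))⁻¹ :=
          mul_le_mul_of_nonneg_right (min_le_left _ _) (by positivity)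
        linarith

/-! second differences -/

lemma sdiff_aux {d : ℕ} {u : Eu d → ℝ} (hu : Differentiable ℝ u) {L : ℝ} (x z : Eu d)
    (h : ∀ t ∈ Icc (0:ℝ) 1, ‖fderiv ℝ u (x + t • z) - fderiv ℝ u (x - t • z)‖ ≤ L * ‖z‖) :
    |2 * u x - u (x + z) - u (x - z)| ≤ L * ‖z‖ ^ 2 := by
  have hd : ∀ t : ℝ, HasDerivAt (fun t : ℝ => u (x + t • z) + u (x - t • z))
      ((fderiv ℝ u (x + t • z) - fderiv ℝ u (x - t • z)) z) t := by
    intro t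
    have h1 : HasDerivAt (fun t : ℝ => x + t • z) z t := by
      simpa using ((hasDerivAt_id t).smul_const z).const_add x
    have h2 : HasDerivAt (fun t : ℝ => x - t • z) (-z) t := by
      simpa using ((hasDerivAt_id t).smul_const z).const_sub x
    have h3 := (hu (x + t • z)).hasFDerivAt.comp_hasDerivAt t h1
    have h4 := (hu (x - t • z)).hasFDerivAt.comp_hasDerivAt t h2
    refine (h3.add h4).congr_deriv ?_
    simp [sub_eq_add_neg]
  have := norm_image_sub_le_of_norm_deriv_le_segment_01' (C := L * ‖z‖ ^ 2)
    (fun t _ => (hd t).hasDerivWithinAt) (fun t ht => by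
      calc _ ≤ ‖fderiv ℝ u (x + t • z) - fderiv ℝ u (x - t • z)‖ * ‖z‖ := ContinuousLinearMap.le_opNorm _ _
        _ ≤ (L * ‖z‖) * ‖z‖ := by gcongr; exact h t ⟨ht.1, ht.2.le⟩
        _ = _ := by ring)
  rw [Real.norm_eq_abs] at this
  simp only [one_smul, zero_smul, add_zero, sub_zero] at this
  rw [← abs_neg]
  convert this using 2
  ring

lemma sdiff_min {a L z : ℝ} (hL : 0 ≤ L) (h1 : z ^ 2 ≤ 1 → a ≤ L * z ^ 2) (h2 : a ≤ 4) :
    a ≤ (L + 4) * min (z ^ 2) 1 := by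
  by_cases h : z ^ 2 ≤ 1
  · rw [min_eq_left h]; nlinarith [h1 h, sq_nonneg z]
  · rw [min_eq_right (by linarith)]; linarith

lemma sdiff_local {d : ℕ} {u : Eu d → ℝ} (hu : ContDiff ℝ 2 u) (hb : ∀ x, |u x| ≤ 1) (r : ℝ) :
    ∃ C : ℝ, 0 ≤ C ∧ ∀ x : Eu d, ‖x‖ ≤ r → ∀ z, |2 * u x - u (x + z) - u (x - z)| ≤ C * min (‖z‖ ^ 2) 1 := by
  have h1 : ContDiff ℝ 1 (fderiv ℝ u) := hu.fderiv_right (by norm_num)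
  obtain ⟨K, hK⟩ := (h1.contDiffOn (s := closedBall (0 : Eu d) (r+1))).exists_lipschitzOnWith (by norm_num)
    (convex_closedBall _ _) (isCompact_closedBall _ _)
  refine ⟨2 * K + 4, by positivity, fun x hx z => ?_⟩
  apply sdiff_min (by positivity)
  · intro hz
    have hz1 : ‖z‖ ≤ 1 := by nlinarith [norm_nonneg z]
    refine sdiff_aux (hu.differentiable (by norm_num)) x z (fun t ht => ?_)
    have hm : ‖t • z‖ ≤ 1 := by
      rw [norm_smul, Real.norm_of_nonneg ht.1]
      nlinarith [norm_nonneg z, ht.1, ht.2]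
    have := hK.dist_le_mul (x + t • z) (by simp; linarith [norm_add_le x (t • z)]) (x - t • z)
      (by simp; linarith [norm_sub_le x (t • z)])
    rw [dist_eq_norm, dist_eq_norm] at this
    refine this.trans ?_
    rw [show x + t • z - (x - t • z) = (2 * t) • z by module, norm_smul, Real.norm_of_nonneg (by linarith [ht.1])]
    have : t * ‖z‖ ≤ 1 * ‖z‖ := by gcongr; exact ht.2
    have hK0 : (0:ℝ) ≤ K := K.2
    nlinarith [mul_le_mul_of_nonneg_left this hK0]
  · have := hb x; have := hb (x + z); have := hb (x - z)
    rw [abs_le] at *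
    constructor <;> linarith

lemma sdiff_integrable {d : ℕ} (hd : 1 ≤ d) {s : ℝ} (hs0 : 1/2 ≤ s) (hs1 : s < 1)
    {u : Eu d → ℝ} (hu : ContDiff ℝ 2 u) (hb : ∀ x, |u x| ≤ 1) (x : Eu d) :
    Integrable (fun z : Eu d => (2 * u x - u (x + z) - u (x - z)) / ‖z‖ ^ ((d : ℝ) + 2*s)) := by
  obtain ⟨C, hC0, hC⟩ := sdiff_local hu hb ‖x‖
  refine ((tker_integrable hd hs0 hs1).const_mul C).mono' ?_ (Filter.Eventually.of_forall fun z => ?_)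
  · have := hu.continuous.measurable
    exact (by fun_prop : Measurable _).aestronglyMeasurable
  · rw [Real.norm_eq_abs, abs_div, abs_of_nonneg (by positivity : (0:ℝ) ≤ ‖z‖ ^ ((d : ℝ) + 2*s)), div_eq_mul_inv,
      tker, ← mul_assoc]
    exact mul_le_mul_of_nonneg_right (hC x le_rfl z) (by positivity)

lemma bump_exists (d : ℕ) : ∃ (χ : Eu d → ℝ) (C : ℝ), 0 ≤ C ∧ ContDiff ℝ 2 χ ∧ χ 0 = 0 ∧ (∀ x, 0 ≤ χ x) ∧ (∀ x, χ x ≤ 1) ∧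
    (∀ x, 2 ≤ ‖x‖ → χ x = 1) ∧ ∀ x z, |2 * χ x - χ (x + z) - χ (x - z)| ≤ C * min (‖z‖ ^ 2) 1 := by
  let f : ContDiffBump (0 : Eu d) := ⟨1, 2, by norm_num, by norm_num⟩
  have hf : ContDiff ℝ 2 (f : Eu d → ℝ) := f.contDiff
  have h1 : ContDiff ℝ 1 (fderiv ℝ (f : Eu d → ℝ)) := hf.fderiv_right (by norm_num)
  obtain ⟨K, hK⟩ := ContDiff.lipschitzWith_of_hasCompactSupport (f.hasCompactSupport.fderiv ℝ) h1 (by norm_num)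
  refine ⟨fun x => 1 - f x, 2 * K + 4, by positivity, by fun_prop, ?_, fun x => by linarith [f.le_one (x := x)],
    fun x => by linarith [f.nonneg (x := x)], fun x hx => ?_, fun x z => ?_⟩
  · have : f 0 = 1 := f.one_of_mem_closedBall (by simp [f])
    simp [this]
  · have : f x = 0 := f.zero_of_le_dist (by simpa [f] using hx)
    simp [this]
  apply sdiff_min (by positivity)
  · intro _
    have := sdiff_aux (hf.differentiable (by norm_num)) x z (L := 2 * K) (fun t ht => ?_)
    · rw [← abs_neg]; convert this using 2; ring
    have := hK.dist_le_mul (x + t • z) (x - t • z)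
    rw [dist_eq_norm, dist_eq_norm] at this
    refine this.trans ?_
    rw [show x + t • z - (x - t • z) = (2 * t) • z by module, norm_smul, Real.norm_of_nonneg (by linarith [ht.1])]
    have : t * ‖z‖ ≤ 1 * ‖z‖ := by gcongr; exact ht.2
    have hK0 : (0:ℝ) ≤ K := K.2
    nlinarith [mul_le_mul_of_nonneg_left this hK0]
  · have h1 := f.nonneg (x := x); have h2 := f.nonneg (x := x + z); have h3 := f.nonneg (x := x - z)
    have h1 := f.le_one (x := x); have h2 := f.le_one (x := x + z); have h3 := f.le_one (x := x - z)
    rw [abs_le]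
    constructor <;> linarith

lemma conc_le {β τ : ℝ} (hβ0 : 0 < β) (hβ1 : β < 1) (h : |τ| ≤ 1) :
    (1 + τ) ^ β + (1 - τ) ^ β ≤ 2 := by
  rw [abs_le] at h
  have h1 := rpow_one_add_le_one_add_mul_self (s := τ) h.1 hβ0.le hβ1.le
  have h2 := rpow_one_add_le_one_add_mul_self (s := -τ) (by linarith) hβ0.le hβ1.le
  rw [← sub_eq_add_neg] at h2
  linarith

lemma conc_lt {β : ℝ} (hβ0 : 0 < β) (hβ1 : β < 1) :
    ∃ c : ℝ, 0 < c ∧ ∀ τ ∈ Icc (1/4 : ℝ) 1, (1 + τ) ^ β + (1 - τ) ^ β ≤ 2 - c := by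
  have hc : ContinuousOn (fun τ : ℝ => (1 + τ) ^ β + (1 - τ) ^ β) (Icc (1/4 : ℝ) 1) := by
    apply Continuous.continuousOn
    apply Continuous.add
    · exact (by fun_prop : Continuous fun τ : ℝ => 1 + τ).rpow_const (fun _ => Or.inr hβ0.le)
    · exact (by fun_prop : Continuous fun τ : ℝ => 1 - τ).rpow_const (fun _ => Or.inr hβ0.le)
  obtain ⟨t, ht, hmax⟩ := isCompact_Icc.exists_isMaxOn (by simp; norm_num) hc
  refine ⟨2 - ((1 + t) ^ β + (1 - t) ^ β), ?_, fun τ hτ => ?_⟩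
  · have h1 := rpow_one_add_lt_one_add_mul_self (s := t) (by linarith [ht.1]) (by linarith [ht.1]) hβ0 hβ1
    have h2 := rpow_one_add_le_one_add_mul_self (s := -t) (by linarith [ht.2]) hβ0.le hβ1.le
    rw [← sub_eq_add_neg] at h2
    linarith
  · have := hmax hτ
    simp only [mem_ofPred_eq] at this
    linarith

lemma twist_integral {d : ℕ} (F : Eu d → ℝ) (hF : Integrable F) (σ : Eu d ≃ₗᵢ[ℝ] Eu d) (ρ : ℝ) :
    Integrable (fun z => if ‖z‖ < ρ then F (σ z) else F z) ∧
    ∫ z, (if ‖z‖ < ρ then F (σ z) else F z) = ∫ z, F z := by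
  have hmp := σ.measurePreserving
  have hme := σ.toHomeomorph.measurableEmbedding
  have hA : MeasurableSet {z : Eu d | ‖z‖ < ρ} := measurableSet_lt (by fun_prop) (by fun_prop)
  set A := {z : Eu d | ‖z‖ < ρ} with hAdef
  have e : (fun z => if ‖z‖ < ρ then F (σ z) else F z) =
      (fun z => (A.indicator F) (σ z)) + (Aᶜ).indicator F := by
    ext z
    by_cases h : ‖z‖ < ρ
    · have h1 : z ∈ A := h
      have h2 : σ z ∈ A := by simpa [hAdef] using h
      simp [h, h1, h2]
    · have h1 : z ∉ A := h
      have h2 : σ z ∉ A := by simpa [hAdef] using h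
      simp [h, h1, h2]
  have i1 : Integrable (A.indicator F) := hF.indicator hA
  have i2 : Integrable (fun z => (A.indicator F) (σ z)) := (hmp.integrable_comp_emb hme).2 i1
  have i3 : Integrable (Aᶜ.indicator F) := hF.indicator hA.compl
  rw [e]
  refine ⟨i2.add i3, ?_⟩
  rw [integral_add' i2 i3, hmp.integral_comp hme, integral_indicator hA, integral_indicator hA.compl,
    integral_add_compl hA hF]

lemma refl_formula {d : ℕ} (a z : Eu d) :
    ((ℝ ∙ a)ᗮ).reflection z = z - (2 * (inner ℝ a z / ‖a‖ ^ 2)) • a := by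
  rw [Submodule.reflection_orthogonal_apply, Submodule.reflection_singleton_apply]
  simp only [RCLike.ofReal_real_eq_id, id_eq]
  module

set_option maxHeartbeats 2000000 in
/-- Ishii-Lions Hölder estimate -/
lemma holder_est {d : ℕ} (hd : 1 ≤ d) {s : ℝ} (hs0 : 1/2 ≤ s) (hs1 : s < 1) {c M β : ℝ} (hc : 0 < c) (hM : 0 ≤ M)
    (hβ0 : 0 < β) (hβ1 : β < 1) :
    ∃ L : ℝ, 0 < L ∧ ∀ u : Eu d → ℝ, ContDiff ℝ 2 u → (∀ x, |u x| ≤ 1) →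
      (∀ x : Eu d, |c * ∫ z : Eu d, (2 * u x - u (x + z) - u (x - z)) / ‖z‖ ^ ((d : ℝ) + 2*s)| ≤ M) →
      ∀ x y, |u x - u y| ≤ L * ‖x - y‖ ^ β := by
  have := eu_nontrivial hd
  obtain ⟨χ, Cχ, hCχ, hχs, hχ00, hχ0, hχ1, hχ2, hχd⟩ := bump_exists d
  obtain ⟨cβ, hcβ, hconc⟩ := conc_lt hβ0 hβ1
  set I := ∫ z, tker d s z with hI
  have hI0 : 0 ≤ I := integral_nonneg (tker_nonneg d s)
  set v := volume.real (ball (0 : Eu d) 1) with hv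
  have hv0 : 0 < v := by
    rw [hv, measureReal_def]
    exact ENNReal.toReal_pos (measure_ball_pos _ _ (by norm_num)).ne' measure_ball_lt_top.ne
  set κ := cβ * (v * (1/8) ^ d) with hκ
  have hκ0 : 0 < κ := by positivity
  set L := 2 + (2 * M / c + 4 * Cχ * I + 1) / κ with hL
  have hL2 : 2 ≤ L := by
    have : 0 ≤ (2 * M / c + 4 * Cχ * I + 1) / κ := by positivity
    linarith
  have hLκ : 2 * M / c + 4 * Cχ * I < L * κ := by
    rw [hL, add_mul, div_mul_cancel₀ _ hκ0.ne']; nlinarith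
  refine ⟨L, by linarith, fun u hu hb heq => ?_⟩
  suffices H : ∀ x y, u x - u y ≤ L * ‖x - y‖ ^ β by
    intro x y
    rw [abs_le]
    have h1 := H x y
    have h2 := H y x
    rw [norm_sub_rev] at h2
    constructor <;> linarith
  by_contra! hcon
  obtain ⟨x₁, y₁, h1⟩ := hcon
  set Φ : Eu d × Eu d → ℝ := fun q => u q.1 - u q.2 - L * ‖q.1 - q.2‖ ^ β - 4 * χ (q.1 - x₁) with hΦ
  have hΦc : Continuous Φ := by
    have h1 := hu.continuous
    have h2 := hχs.continuous
    have h3 : Continuous (fun q : Eu d × Eu d => ‖q.1 - q.2‖ ^ β) :=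
      (by fun_prop : Continuous fun q : Eu d × Eu d => ‖q.1 - q.2‖).rpow_const (fun _ => Or.inr hβ0.le)
    fun_prop
  have hΦ1 : 0 < Φ (x₁, y₁) := by simp [hΦ, hχ00]; linarith
  -- points with positive value are in a compact set
  have hloc : ∀ q, 0 < Φ q → ‖q.1 - x₁‖ < 2 ∧ ‖q.1 - q.2‖ < 1 := by
    intro q hq
    simp only [hΦ] at hq
    have b1 := abs_le.1 (hb q.1)
    have b2 := abs_le.1 (hb q.2)
    have p1 : 0 ≤ L * ‖q.1 - q.2‖ ^ β := by positivity
    constructor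
    · by_contra! h
      rw [hχ2 _ h] at hq
      linarith
    · by_contra! h
      have : 1 ≤ ‖q.1 - q.2‖ ^ β := Real.one_le_rpow h hβ0.le
      nlinarith [hχ0 (q.1 - x₁)]
  obtain ⟨q, hq, hmax⟩ := ((isCompact_closedBall x₁ 2).prod (isCompact_closedBall x₁ 3)).exists_isMaxOn
    (f := Φ) ⟨(x₁, x₁), by simp⟩ hΦc.continuousOn
  have hin : ∀ q, 0 < Φ q → q ∈ closedBall x₁ 2 ×ˢ closedBall x₁ 3 := by
    intro q hq
    obtain ⟨a1, a2⟩ := hloc q hq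
    simp only [mem_prod, mem_closedBall, dist_eq_norm]
    refine ⟨a1.le, ?_⟩
    calc ‖q.2 - x₁‖ = ‖(q.1 - x₁) - (q.1 - q.2)‖ := by congr 1; abel
      _ ≤ _ := norm_sub_le _ _
      _ ≤ 3 := by linarith
  have hqpos : 0 < Φ q := hΦ1.trans_le (hmax (hin _ hΦ1))
  have hglob : ∀ q', Φ q' ≤ Φ q := by
    intro q'
    by_cases h : 0 < Φ q'
    · exact hmax (hin _ h)
    · linarith
  obtain ⟨x, y⟩ := q
  set a := x - y with ha
  set r := ‖a‖ with hr
  have hr1 : r < 1 := (hloc _ hqpos).2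
  have hr0 : 0 < r := by
    rw [hr, norm_pos_iff]
    intro h0
    have hxy : x = y := sub_eq_zero.1 h0
    simp only [hΦ, ← hxy, sub_self, norm_zero, Real.zero_rpow hβ0.ne'] at hqpos
    linarith [hχ0 (x - x₁)]
  have hstep : ∀ z z' : Eu d, u (x + z) - u (y + z') - (u x - u y) ≤
      L * (‖a + (z - z')‖ ^ β - r ^ β) + 4 * (χ (x - x₁ + z) - χ (x - x₁)) := by
    intro z z'
    have := hglob (x + z, y + z')
    simp only [hΦ] at this
    rw [show x + z - (y + z') = a + (z - z') by rw [ha]; abel, show x + z - x₁ = x - x₁ + z by abel] at this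
    rw [hr]
    linarith
  set p : ℝ := (d:ℝ) + 2*s with hp
  set σ := ((ℝ ∙ a)ᗮ).reflection with hσ
  set D : Eu d → Eu d → ℝ := fun x z => 2 * u x - u (x + z) - u (x - z) with hD
  have iX : Integrable (fun z => D x z / ‖z‖ ^ p) := sdiff_integrable hd hs0 hs1 hu hb x
  have iY : Integrable (fun z => D y z / ‖z‖ ^ p) := sdiff_integrable hd hs0 hs1 hu hb y
  obtain ⟨iT, eT⟩ := twist_integral _ iY σ (r/2)
  have hIneq : (∫ z, D x z / ‖z‖ ^ p) - (∫ z, D y z / ‖z‖ ^ p) ≤ 2 * M / c := by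
    have e1 := abs_le.1 (heq x)
    have e2 := abs_le.1 (heq y)
    rw [le_div_iff₀ hc]
    simp only [hD]
    linarith
  rw [← eT, ← integral_sub iX iT] at hIneq
  -- lower bound
  set B := ball ((1/4 : ℝ) • a) (r/8) with hB
  have iLow : Integrable (fun z => B.indicator (fun _ => L * r ^ β * cβ * (r ^ p)⁻¹) z - 4 * Cχ * tker d s z) := by
    refine Integrable.sub ?_ ((tker_integrable hd hs0 hs1).const_mul _)
    rw [integrable_indicator_iff measurableSet_ball]
    exact integrableOn_const (by exact measure_ball_lt_top.ne)
  have hpw : ∀ z, B.indicator (fun _ => L * r ^ β * cβ * (r ^ p)⁻¹) z - 4 * Cχ * tker d s z ≤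
      D x z / ‖z‖ ^ p - (if ‖z‖ < r / 2 then D y (σ z) / ‖σ z‖ ^ p else D y z / ‖z‖ ^ p) := by
    intro z
    have hk : 0 ≤ (‖z‖ ^ p)⁻¹ := by positivity
    have hχz : - (Cχ * min (‖z‖ ^ 2) 1) ≤ 2 * χ (x - x₁) - χ (x - x₁ + z) - χ (x - x₁ - z) :=
      (abs_le.1 (hχd (x - x₁) z)).1
    by_cases hz : ‖z‖ < r / 2
    · rw [if_pos hz, LinearIsometryEquiv.norm_map, ← sub_div, div_eq_mul_inv]
      have s1 := hstep z (σ z)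
      have s2 := hstep (-z) (-(σ z))
      set t := inner ℝ a z / ‖a‖ ^ 2 with ht
      have e0 : z - σ z = (2 * t) • a := by rw [hσ, refl_formula]; abel
      have e1 : ‖a + (z - σ z)‖ = |1 + 2 * t| * r := by
        rw [e0, hr, ← Real.norm_eq_abs, ← norm_smul]; congr 1; module
      have e2 : ‖a + (-z - -(σ z))‖ = |1 - 2 * t| * r := by
        rw [show -z - -(σ z) = -(z - σ z) by abel, e0, hr, ← Real.norm_eq_abs, ← norm_smul]; congr 1; module
      have htabs : |2 * t| ≤ 1 := by
        have : |inner ℝ a z| ≤ r * ‖z‖ := abs_real_inner_le_norm a z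
        rw [ht, abs_mul, abs_div, abs_of_nonneg (by positivity : (0:ℝ) ≤ ‖a‖ ^ 2), ← hr]
        rw [abs_of_pos (by norm_num : (0:ℝ) < 2), ← mul_div_assoc, div_le_one (by positivity)]
        nlinarith
      have ht2 := abs_le.1 htabs
      rw [e1, abs_of_nonneg (by linarith), Real.mul_rpow (by linarith) hr0.le] at s1
      rw [e2, abs_of_nonneg (by linarith), Real.mul_rpow (by linarith) hr0.le] at s2
      have hLr : 0 ≤ L * r ^ β := by positivity
      have hmain : L * r ^ β * (2 - ((1 + 2*t) ^ β + (1 - 2*t) ^ β)) - 4 * (Cχ * min (‖z‖ ^ 2) 1)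
          ≤ D x z - D y (σ z) := by
        simp only [hD]
        rw [← sub_eq_add_neg] at s2
        rw [← sub_eq_add_neg, ← sub_eq_add_neg] at s2
        nlinarith
      by_cases hzB : z ∈ B
      · rw [indicator_of_mem hzB]
        have hzB' : ‖z - (1/4 : ℝ) • a‖ < r / 8 := by simpa [hB, dist_eq_norm] using hzB
        have hin1 : inner ℝ a z = r ^ 2 / 4 + inner ℝ a (z - (1/4 : ℝ) • a) := by
          rw [inner_sub_right, inner_smul_right, real_inner_self_eq_norm_sq]; ring
        have hin2 := abs_le.1 (abs_real_inner_le_norm a (z - (1/4 : ℝ) • a))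
        have hin3 : ‖a‖ * ‖z - (1/4 : ℝ) • a‖ ≤ r * (r / 8) := by rw [← hr]; gcongr
        have ht4 : 1/4 ≤ 2 * t := by
          rw [ht, ← hr, ← mul_div_assoc, le_div_iff₀ (by positivity)]
          nlinarith [hin2.1]
        have hcc := hconc (2 * t) ⟨ht4, ht2.2⟩
        have hz0 : 0 < ‖z‖ := by
          rw [norm_pos_iff]; rintro rfl
          simp [ht] at ht4; linarith
        have hkk : (r ^ p)⁻¹ ≤ (‖z‖ ^ p)⁻¹ := by
          apply inv_anti₀ (by positivity)
          exact Real.rpow_le_rpow hz0.le (by linarith) (by rw [hp]; positivity)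
        unfold tker
        calc L * r ^ β * cβ * (r ^ p)⁻¹ - 4 * Cχ * (min (‖z‖ ^ 2) 1 * (‖z‖ ^ p)⁻¹)
            ≤ L * r ^ β * cβ * (‖z‖ ^ p)⁻¹ - 4 * Cχ * (min (‖z‖ ^ 2) 1 * (‖z‖ ^ p)⁻¹) := by gcongr
          _ = (L * r ^ β * cβ - 4 * (Cχ * min (‖z‖ ^ 2) 1)) * (‖z‖ ^ p)⁻¹ := by ring
          _ ≤ _ := by
            apply mul_le_mul_of_nonneg_right _ hk
            refine le_trans ?_ hmain
            have := mul_le_mul_of_nonneg_left (by linarith : cβ ≤ 2 - ((1 + 2*t) ^ β + (1 - 2*t) ^ β)) hLr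
            linarith
      · rw [indicator_of_notMem hzB]
        unfold tker
        calc (0:ℝ) - 4 * Cχ * (min (‖z‖ ^ 2) 1 * (‖z‖ ^ p)⁻¹)
            = (0 - 4 * (Cχ * min (‖z‖ ^ 2) 1)) * (‖z‖ ^ p)⁻¹ := by ring
          _ ≤ _ := by
            apply mul_le_mul_of_nonneg_right _ hk
            refine le_trans ?_ hmain
            have := mul_nonneg hLr (by linarith [conc_le hβ0 hβ1 htabs] : 0 ≤ 2 - ((1 + 2*t) ^ β + (1 - 2*t) ^ β))
            linarith
    · rw [if_neg hz, ← sub_div, div_eq_mul_inv]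
      have hzB : z ∉ B := by
        intro h
        have hzB' : ‖z - (1/4 : ℝ) • a‖ < r / 8 := by simpa [hB, dist_eq_norm] using h
        have : ‖z‖ ≤ ‖z - (1/4 : ℝ) • a‖ + ‖(1/4 : ℝ) • a‖ := by
          simpa using norm_add_le (z - (1/4 : ℝ) • a) ((1/4 : ℝ) • a)
        rw [norm_smul, ← hr] at this
        norm_num at this
        linarith
      rw [indicator_of_notMem hzB]
      have s1 := hstep z z
      have s2 := hstep (-z) (-z)
      simp only [sub_self, add_zero, mul_zero, zero_add, ← hr, ← sub_eq_add_neg] at s1 s2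
      unfold tker
      calc (0:ℝ) - 4 * Cχ * (min (‖z‖ ^ 2) 1 * (‖z‖ ^ p)⁻¹)
            = (0 - 4 * (Cχ * min (‖z‖ ^ 2) 1)) * (‖z‖ ^ p)⁻¹ := by ring
        _ ≤ _ := by
          apply mul_le_mul_of_nonneg_right _ hk
          simp only [hD]
          linarith
  have hfin := integral_mono iLow (iX.sub iT) hpw
  rw [integral_sub ((integrable_indicator_iff measurableSet_ball).2
      (integrableOn_const (by exact measure_ball_lt_top.ne)))
      ((tker_integrable hd hs0 hs1).const_mul _), integral_indicator measurableSet_ball, setIntegral_const,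
      integral_const_mul, ← hI] at hfin
  have hvol : volume.real B = (r/8) ^ d * v := by
    rw [hB, measureReal_def, Measure.addHaar_ball _ _ (by positivity), ENNReal.toReal_mul,
      ENNReal.toReal_ofReal (by positivity), hv, measureReal_def]
    simp
  rw [hvol, smul_eq_mul] at hfin
  have hrr : 1 ≤ r ^ d * r ^ β * (r ^ p)⁻¹ := by
    rw [← Real.rpow_natCast, ← Real.rpow_neg hr0.le, ← Real.rpow_add hr0, ← Real.rpow_add hr0]
    apply Real.one_le_rpow_of_pos_of_le_one_of_nonpos hr0 hr1.le
    rw [hp]; linarith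
  have : L * κ ≤ (r/8) ^ d * v * (L * r ^ β * cβ * (r ^ p)⁻¹) := by
    have e : (r/8) ^ d * v * (L * r ^ β * cβ * (r ^ p)⁻¹) = L * κ * (r ^ d * r ^ β * (r ^ p)⁻¹) := by
      rw [hκ, div_eq_mul_one_div r 8, mul_pow]; ring
    rw [e]
    have : 0 ≤ L * κ := by positivity
    nlinarith
  have hfin2 := hfin.trans hIneq
  linarith

noncomputable def domb (d : ℕ) (s r : ℝ) (q : Eu d × Eu d) : ℝ :=
  (closedBall (0 : Eu d) r).indicator (fun _ => (1:ℝ)) q.1 * tker d s (q.2 - q.1) +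
  (closedBall (0 : Eu d) r).indicator (fun _ => (1:ℝ)) q.2 * tker d s (q.1 - q.2)

lemma domb_integrable {d : ℕ} (hd : 1 ≤ d) {s : ℝ} (hs0 : 1/2 ≤ s) (hs1 : s < 1) (r : ℝ) :
    Integrable (domb d s r) (volume.prod volume) := by
  have i1 : Integrable ((closedBall (0 : Eu d) r).indicator (fun _ => (1:ℝ))) := by
    rw [integrable_indicator_iff measurableSet_closedBall]
    exact integrableOn_const (by exact measure_closedBall_lt_top.ne)
  have i2 := i1.mul_prod (tker_integrable hd hs0 hs1)
  have mp := measurePreserving_prod_neg_add (volume : Measure (Eu d)) (volume : Measure (Eu d))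
  have i3 := mp.integrable_comp_of_integrable i2
  have e3 : ((fun z : Eu d × Eu d => (closedBall (0 : Eu d) r).indicator (fun _ => (1:ℝ)) z.1 * tker d s z.2) ∘
      fun z => (z.1, -z.1 + z.2)) = fun q : Eu d × Eu d => (closedBall (0 : Eu d) r).indicator (fun _ => (1:ℝ)) q.1 * tker d s (q.2 - q.1) := by
    ext q; simp only [Function.comp]; rw [neg_add_eq_sub]
  rw [e3] at i3
  exact i3.add i3.swap

lemma domb_of {d : ℕ} {s r A : ℝ} {x y : Eu d} {a : ℝ} (hA : 0 ≤ A)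
    (h0 : r < ‖x‖ → r < ‖y‖ → a = 0) (h : ‖x‖ ≤ r ∨ ‖y‖ ≤ r → |a| ≤ A * min (‖x - y‖ ^ 2) 1) :
    ‖a / ‖x - y‖ ^ ((d : ℝ) + 2*s)‖ ≤ A * domb d s r (x, y) := by
  have hx : 0 ≤ (closedBall (0 : Eu d) r).indicator (fun _ => (1:ℝ)) x := indicator_nonneg (by simp) _
  have hy : 0 ≤ (closedBall (0 : Eu d) r).indicator (fun _ => (1:ℝ)) y := indicator_nonneg (by simp) _
  have hK : 0 ≤ tker d s (x - y) := tker_nonneg _ _ _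
  have e : tker d s (y - x) = tker d s (x - y) := by rw [← tker_neg]; congr 1; abel
  unfold domb
  simp only [e]
  by_cases hh : ‖x‖ ≤ r ∨ ‖y‖ ≤ r
  · have h1 : 1 ≤ (closedBall (0 : Eu d) r).indicator (fun _ => (1:ℝ)) x + (closedBall (0 : Eu d) r).indicator (fun _ => (1:ℝ)) y := by
      rcases hh with hh | hh
      · rw [indicator_of_mem (by simpa using hh : x ∈ _)]; linarith
      · rw [indicator_of_mem (by simpa using hh : y ∈ _)]; linarith
    rw [norm_div, Real.norm_eq_abs, Real.norm_of_nonneg (by positivity : (0:ℝ) ≤ ‖x-y‖ ^ ((d : ℝ) + 2*s)), div_eq_mul_inv]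
    calc |a| * (‖x-y‖ ^ ((d : ℝ) + 2*s))⁻¹ ≤ A * min (‖x - y‖ ^ 2) 1 * (‖x-y‖ ^ ((d : ℝ) + 2*s))⁻¹ :=
          mul_le_mul_of_nonneg_right (h hh) (by positivity)
      _ = A * (1 * tker d s (x - y)) := by rw [tker]; ring
      _ ≤ _ := by rw [← add_mul]; gcongr
  · push Not at hh
    rw [h0 hh.1 hh.2]
    simp only [zero_div, norm_zero]
    positivity

/-- Lipschitz, bounded, compact support -/
def LC {d : ℕ} (L r : ℝ) (η : Eu d → ℝ) : Prop :=
  0 ≤ L ∧ (∀ x y, |η x - η y| ≤ L * ‖x - y‖) ∧ (∀ x, |η x| ≤ L) ∧ ∀ x, r < ‖x‖ → η x = 0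

lemma LC.continuous {d : ℕ} {L r : ℝ} {η : Eu d → ℝ} (h : LC L r η) : Continuous η := by
  have : LipschitzWith ⟨L, h.1⟩ η := LipschitzWith.of_dist_le_mul fun x y => by
    rw [dist_eq_norm, dist_eq_norm]; exact h.2.1 x y
  exact this.continuous

lemma LC.hasCompactSupport {d : ℕ} {L r : ℝ} {η : Eu d → ℝ} (h : LC L r η) : HasCompactSupport η :=
  HasCompactSupport.intro (isCompact_closedBall 0 r) fun x hx => h.2.2.2 x (by simpa using hx)

lemma LC.sub_le {d : ℕ} {L r : ℝ} {η : Eu d → ℝ} (h : LC L r η) (x y : Eu d) :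
    |η x - η y| ≤ 2 * L * min ‖x - y‖ 1 := by
  obtain ⟨h0, h1, h2, h3⟩ := h
  rcases min_cases ‖x - y‖ 1 with ⟨e, _⟩ | ⟨e, _⟩ <;> rw [e]
  · have := h1 x y; nlinarith [norm_nonneg (x - y)]
  · have := abs_sub (η x) (η y); linarith [h2 x, h2 y]

lemma min_sq (a : ℝ) (ha : 0 ≤ a) : min (a ^ 2) 1 = min a 1 * min a 1 := by
  rcases le_total a 1 with h | h
  · rw [min_eq_left h, min_eq_left (by nlinarith)]; ring
  · rw [min_eq_right h, min_eq_right (by nlinarith)]; ring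

lemma LC.dom {d : ℕ} {s L r : ℝ} {η : Eu d → ℝ} (h : LC L r η) (x y : Eu d) :
    ‖(η x - η y)^2 / ‖x - y‖ ^ ((d : ℝ) + 2*s)‖ ≤ 4 * L ^ 2 * domb d s r (x, y) := by
  apply domb_of (by positivity)
  · intro hx hy; rw [h.2.2.2 x hx, h.2.2.2 y hy]; simp
  · intro _
    rw [abs_pow, min_sq _ (norm_nonneg _)]
    have := h.sub_le x y
    calc |η x - η y| ^ 2 ≤ (2 * L * min ‖x - y‖ 1) ^ 2 := by gcongr
      _ = _ := by ring

lemma LC.integrable_sq {d : ℕ} (hd : 1 ≤ d) {s : ℝ} (hs0 : 1/2 ≤ s) (hs1 : s < 1) {L r : ℝ} {η : Eu d → ℝ} (h : LC L r η) :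
    Integrable (fun q : Eu d × Eu d => (η q.1 - η q.2)^2 / ‖q.1 - q.2‖ ^ ((d : ℝ) + 2*s)) (volume.prod volume) := by
  refine ((domb_integrable hd hs0 hs1 r).const_mul (4 * L ^ 2)).mono' ?_ (Filter.Eventually.of_forall fun q => h.dom q.1 q.2)
  have := h.continuous.measurable
  exact (by fun_prop : Measurable _).aestronglyMeasurable

lemma mollify {d : ℕ} {L r : ℝ} {η : Eu d → ℝ} (h : LC L r η) {ε : ℝ} (hε : 0 < ε) (hε1 : ε ≤ 1) :
    ∃ η' : Eu d → ℝ, ContDiff ℝ (⊤ : ℕ∞) η' ∧ LC L (r + 1) η' ∧ ∀ x, |η' x - η x| ≤ L * ε := by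
  let φ : ContDiffBump (0 : Eu d) := ⟨ε/2, ε, by positivity, by linarith⟩
  let ρ := φ.normed (volume : Measure (Eu d))
  let η' := convolution ρ η (ContinuousLinearMap.lsmul ℝ ℝ) volume
  have hρ0 : ∀ t, 0 ≤ ρ t := φ.nonneg_normed
  have hρ1 : ∫ t, ρ t = 1 := φ.integral_normed
  have hρc : Continuous ρ := φ.continuous_normed
  have hρcs : HasCompactSupport ρ := φ.hasCompactSupport_normed
  have hρi : Integrable ρ := hρc.integrable_of_hasCompactSupport hρcs
  have hηc := h.continuous
  have hform : ∀ x, η' x = ∫ t, ρ t * η (x - t) := fun x => by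
    simp only [η', convolution, ContinuousLinearMap.lsmul_apply, smul_eq_mul]
  have hint : ∀ x, Integrable (fun t => ρ t * η (x - t)) := fun x => by
    apply Continuous.integrable_of_hasCompactSupport (by fun_prop)
    exact hρcs.mul_right
  obtain ⟨h0, h1, h2, h3⟩ := h
  refine ⟨η', ?_, ⟨h0, fun x y => ?_, fun x => ?_, fun x hx => ?_⟩, fun x => ?_⟩
  · exact hρcs.contDiff_convolution_left _ φ.contDiff_normed hηc.locallyIntegrable
  · rw [hform, hform, ← integral_sub (hint x) (hint y), ← Real.norm_eq_abs]
    calc _ ≤ ∫ t, ρ t * (L * ‖x - y‖) := by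
          apply norm_integral_le_of_norm_le (hρi.mul_const _) (Filter.Eventually.of_forall fun t => ?_)
          rw [← mul_sub, norm_mul, Real.norm_of_nonneg (hρ0 t), Real.norm_eq_abs]
          have := h1 (x - t) (y - t)
          rw [sub_sub_sub_cancel_right] at this
          exact mul_le_mul_of_nonneg_left this (hρ0 t)
      _ = _ := by rw [integral_mul_const, hρ1, one_mul]
  · rw [hform, ← Real.norm_eq_abs]
    calc _ ≤ ∫ t, ρ t * L := by
          apply norm_integral_le_of_norm_le (hρi.mul_const _) (Filter.Eventually.of_forall fun t => ?_)
          rw [norm_mul, Real.norm_of_nonneg (hρ0 t), Real.norm_eq_abs]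
          exact mul_le_mul_of_nonneg_left (h2 _) (hρ0 t)
      _ = _ := by rw [integral_mul_const, hρ1, one_mul]
  · rw [hform]
    rw [integral_eq_zero_of_ae (Filter.Eventually.of_forall fun t => ?_)]
    by_cases ht : ‖t‖ < ε
    · have : r < ‖x - t‖ := by
        have := norm_sub_norm_le x t
        linarith
      simp [h3 _ this]
    · have : ρ t = 0 := by
        have : t ∉ Function.support ρ := by
          rw [φ.support_normed_eq]; simpa [φ] using ht
        simpa using this
      simp [this]
  · have := φ.dist_normed_convolution_le (μ := volume) (x₀ := x) (g := η) (ε := L * ε) hηc.aestronglyMeasurable (fun y hy => by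
      rw [dist_eq_norm]
      refine (h1 y x).trans ?_
      have : ‖y - x‖ < ε := by simpa [φ, dist_eq_norm] using hy
      gcongr)
    rwa [Real.dist_eq] at this

lemma stab_ext {d : ℕ} (hd : 1 ≤ d) {s : ℝ} (hs0 : 1/2 ≤ s) (hs1 : s < 1) {c : ℝ} {g : Eu d → ℝ} (hg : Continuous g)
    (hst : ∀ η : Eu d → ℝ, ContDiff ℝ (⊤ : ℕ∞) η → HasCompactSupport η →
      ∫ x, g x * (η x)^2 ≤ c * ∫ x : Eu d, ∫ y : Eu d, (η x - η y)^2 / ‖x - y‖ ^ ((d : ℝ) + 2*s))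
    {L r : ℝ} {η : Eu d → ℝ} (h : LC L r η) :
    ∫ x, g x * (η x)^2 ≤ c * ∫ q : Eu d × Eu d, (η q.1 - η q.2)^2 / ‖q.1 - q.2‖ ^ ((d : ℝ) + 2*s) ∂(volume.prod volume) := by
  have hex : ∀ n : ℕ, ∃ η' : Eu d → ℝ, ContDiff ℝ (⊤ : ℕ∞) η' ∧ LC L (r + 1) η' ∧ ∀ x, |η' x - η x| ≤ L * (1 / ((n:ℝ) + 1)) := by
    intro n
    apply mollify h (by positivity)
    rw [div_le_one (by positivity)]; linarith [(Nat.cast_nonneg n : (0:ℝ) ≤ n)]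
  choose η' hs hLC happ using hex
  have hlim : ∀ x, Filter.Tendsto (fun n => η' n x) Filter.atTop (nhds (η x)) := by
    intro x
    rw [tendsto_iff_dist_tendsto_zero]
    refine squeeze_zero (g := fun n : ℕ => L * (1 / ((n:ℝ) + 1))) (fun _ => dist_nonneg) (fun n => by rw [Real.dist_eq]; exact happ n x) ?_
    simpa using (tendsto_one_div_add_atTop_nhds_zero_nat (𝕜 := ℝ)).const_mul L
  have l1 : Filter.Tendsto (fun n => ∫ x, g x * (η' n x)^2) Filter.atTop (nhds (∫ x, g x * (η x)^2)) := by
    apply tendsto_integral_of_dominated_convergence ((closedBall (0 : Eu d) (r+1)).indicator (fun x => |g x| * L ^ 2))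
    · intro n
      have := (hLC n).continuous
      exact (by fun_prop : Continuous _).aestronglyMeasurable
    · rw [integrable_indicator_iff measurableSet_closedBall]
      apply ContinuousOn.integrableOn_compact (isCompact_closedBall _ _)
      fun_prop
    · intro n
      refine Filter.Eventually.of_forall fun x => ?_
      by_cases hx : x ∈ closedBall (0 : Eu d) (r+1)
      · rw [indicator_of_mem hx, norm_mul, norm_pow, Real.norm_eq_abs, Real.norm_eq_abs]
        gcongr
        exact (hLC n).2.2.1 x
      · rw [indicator_of_notMem hx, (hLC n).2.2.2 x (by simpa using hx)]; simp
    · refine Filter.Eventually.of_forall fun x => ?_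
      exact ((hlim x).pow 2).const_mul _
  have l2 : Filter.Tendsto (fun n => ∫ q : Eu d × Eu d, (η' n q.1 - η' n q.2)^2 / ‖q.1 - q.2‖ ^ ((d : ℝ) + 2*s) ∂(volume.prod volume))
      Filter.atTop (nhds (∫ q : Eu d × Eu d, (η q.1 - η q.2)^2 / ‖q.1 - q.2‖ ^ ((d : ℝ) + 2*s) ∂(volume.prod volume))) := by
    apply tendsto_integral_of_dominated_convergence (fun q => 4 * L ^ 2 * domb d s (r + 1) q)
    · intro n; exact ((hLC n).integrable_sq hd hs0 hs1).aestronglyMeasurable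
    · exact (domb_integrable hd hs0 hs1 (r+1)).const_mul (4 * L ^ 2)
    · intro n; exact Filter.Eventually.of_forall fun q => (hLC n).dom q.1 q.2
    · refine Filter.Eventually.of_forall fun q => ?_
      exact (((hlim q.1).sub (hlim q.2)).pow 2).div_const _
  refine le_of_tendsto_of_tendsto' l1 (l2.const_mul c) fun n => ?_
  have := hst (η' n) (hs n) (hLC n).hasCompactSupport
  rwa [← integral_prod (fun q : Eu d × Eu d => (η' n q.1 - η' n q.2)^2 / ‖q.1 - q.2‖ ^ ((d : ℝ) + 2*s)) ((hLC n).integrable_sq hd hs0 hs1)] at this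

lemma u_sub_le {d : ℕ} {u : Eu d → ℝ} (hu : ContDiff ℝ 2 u) {b : ℝ} (hb0 : 0 ≤ b) (hb : ∀ x, |u x| ≤ b) (r : ℝ) :
    ∃ K : ℝ, 0 ≤ K ∧ ∀ x y : Eu d, (‖x‖ ≤ r ∨ ‖y‖ ≤ r) → |u x - u y| ≤ K * min ‖x - y‖ 1 := by
  obtain ⟨K, hK⟩ := (hu.contDiffOn (s := closedBall (0 : Eu d) (r+1))).exists_lipschitzOnWith (by norm_num)
    (convex_closedBall _ _) (isCompact_closedBall _ _)
  refine ⟨K + 2 * b, by positivity, fun x y hxy => ?_⟩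
  rcases le_total ‖x - y‖ 1 with h | h
  · rw [min_eq_left h]
    have hx : ‖x‖ ≤ r + 1 := by
      rcases hxy with h' | h'
      · linarith
      · have := norm_sub_norm_le x y; linarith
    have hy : ‖y‖ ≤ r + 1 := by
      rcases hxy with h' | h'
      · have := norm_sub_norm_le y x; rw [norm_sub_rev] at this; linarith
      · linarith
    have := hK.dist_le_mul x (by simpa using hx) y (by simpa using hy)
    rw [dist_eq_norm, dist_eq_norm, Real.norm_eq_abs] at this
    nlinarith [norm_nonneg (x - y)]
  · rw [min_eq_right h]
    have := abs_sub (u x) (u y)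
    have hK0 : (0:ℝ) ≤ K := K.2
    linarith [hb x, hb y]

lemma form_integrable {d : ℕ} (hd : 1 ≤ d) {s : ℝ} (hs0 : 1/2 ≤ s) (hs1 : s < 1) {u : Eu d → ℝ} (hu : ContDiff ℝ 2 u)
    {b : ℝ} (hb0 : 0 ≤ b) (hb : ∀ x, |u x| ≤ b) {L r : ℝ} {ψ : Eu d → ℝ} (h : LC L r ψ) :
    Integrable (fun q : Eu d × Eu d => (ψ q.1 - ψ q.2) * (u q.1 - u q.2) / ‖q.1 - q.2‖ ^ ((d : ℝ) + 2*s)) (volume.prod volume) := by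
  obtain ⟨K, hK0, hK⟩ := u_sub_le hu hb0 hb r
  have hL0 := h.1
  refine ((domb_integrable hd hs0 hs1 r).const_mul (2 * L * K)).mono' ?_ (Filter.Eventually.of_forall fun q => ?_)
  · have := h.continuous.measurable
    have := hu.continuous.measurable
    exact (by fun_prop : Measurable _).aestronglyMeasurable
  · obtain ⟨x, y⟩ := q
    apply domb_of (by positivity)
    · intro hx hy; rw [h.2.2.2 x hx, h.2.2.2 y hy]; simp
    · intro hxy
      rw [abs_mul, min_sq _ (norm_nonneg _)]
      calc _ ≤ (2 * L * min ‖x - y‖ 1) * (K * min ‖x - y‖ 1) := by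
            gcongr
            · exact h.sub_le x y
            · exact hK x y hxy
        _ = _ := by ring

lemma weak_form {d : ℕ} (hd : 1 ≤ d) {s : ℝ} (hs0 : 1/2 ≤ s) (hs1 : s < 1) {u : Eu d → ℝ} (hu : ContDiff ℝ 2 u)
    (hb : ∀ x, |u x| ≤ 1) {L r : ℝ} {ψ : Eu d → ℝ} (h : LC L r ψ) :
    ∫ x, ψ x * ∫ z : Eu d, (2 * u x - u (x + z) - u (x - z)) / ‖z‖ ^ ((d : ℝ) + 2*s) =
    ∫ q : Eu d × Eu d, (ψ q.1 - ψ q.2) * (u q.1 - u q.2) / ‖q.1 - q.2‖ ^ ((d : ℝ) + 2*s) ∂(volume.prod volume) := by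
  have hψc := h.continuous
  have hψcs := h.hasCompactSupport
  have huc := hu.continuous
  have iG := form_integrable hd hs0 hs1 hu zero_le_one hb h
  set G : Eu d × Eu d → ℝ := (fun q : Eu d × Eu d => (ψ q.1 - ψ q.2) * (u q.1 - u q.2) / ‖q.1 - q.2‖ ^ ((d : ℝ) + 2*s)) with hG
  have mp := measurePreserving_prod_add (volume : Measure (Eu d)) (volume : Measure (Eu d))
  have hme : MeasurableEmbedding (fun z : Eu d × Eu d => (z.1, z.1 + z.2)) :=
    (MeasurableEquiv.shearAddRight (Eu d)).measurableEmbedding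
  have iG' : Integrable (fun q : Eu d × Eu d => G (q.1, q.1 + q.2)) (volume.prod volume) := (mp.integrable_comp_emb hme).2 iG
  obtain ⟨C, hC0, hC⟩ := sdiff_local hu hb r
  have iH : Integrable (fun q : Eu d × Eu d => ψ q.1 * ((2 * u q.1 - u (q.1 + q.2) - u (q.1 - q.2)) / ‖q.2‖ ^ ((d : ℝ) + 2*s))) (volume.prod volume) := by
    have i0 := ((hψc.integrable_of_hasCompactSupport hψcs (μ := volume)).norm.mul_const C).mul_prod (tker_integrable hd hs0 hs1)
    refine i0.mono' ?_ (Filter.Eventually.of_forall fun q => ?_)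
    · exact (by fun_prop : Measurable _).aestronglyMeasurable
    · by_cases hq : ‖q.1‖ ≤ r
      · rw [norm_mul, mul_assoc]
        apply mul_le_mul_of_nonneg_left _ (norm_nonneg _)
        rw [Real.norm_eq_abs, abs_div, abs_of_nonneg (by positivity : (0:ℝ) ≤ ‖q.2‖ ^ ((d : ℝ) + 2*s)), div_eq_mul_inv,
          tker, ← mul_assoc]
        exact mul_le_mul_of_nonneg_right (hC q.1 hq q.2) (by positivity)
      · rw [h.2.2.2 q.1 (by linarith)]; simp
  rw [← mp.integral_comp hme G, integral_prod_symm _ iG']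
  simp_rw [← integral_const_mul]
  rw [integral_integral_swap iH]
  congr 1; ext z
  have e1 : ∀ x, G (x, x + z) = ((ψ x - ψ (x + z)) * (u x - u (x + z))) * (‖z‖ ^ ((d : ℝ) + 2*s))⁻¹ := by
    intro x; simp [hG, div_eq_mul_inv]
  have e2 : ∀ x, ψ x * ((2 * u x - u (x + z) - u (x - z)) / ‖z‖ ^ ((d : ℝ) + 2*s)) =
      (ψ x * (u x - u (x + z)) + ψ x * (u x - u (x - z))) * (‖z‖ ^ ((d : ℝ) + 2*s))⁻¹ := by
    intro x; rw [div_eq_mul_inv]; ring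
  simp only [e1, e2]
  rw [integral_mul_const, integral_mul_const]
  congr 1
  have j1 : Integrable (fun x => ψ x * (u x - u (x + z))) :=
    Continuous.integrable_of_hasCompactSupport (by fun_prop) hψcs.mul_right
  have j2 : Integrable (fun x => ψ x * (u x - u (x - z))) :=
    Continuous.integrable_of_hasCompactSupport (by fun_prop) hψcs.mul_right
  have j3 : Integrable (fun x => ψ (x + z) * (u (x + z) - u (x + z - z))) := j2.comp_add_right z
  rw [integral_add j1 j2, ← integral_add_right_eq_self (fun x => ψ x * (u x - u (x - z))) z, ← integral_add j1 j3]
  congr 1; ext x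
  rw [add_sub_cancel_right]; ring

noncomputable def cut {d : ℕ} (x₀ : Eu d) (R : ℝ) (x : Eu d) : ℝ := max 0 (min 1 (2 - ‖x - x₀‖ / R))

lemma cut_nonneg {d : ℕ} (x₀ : Eu d) (R : ℝ) (x : Eu d) : 0 ≤ cut x₀ R x := le_max_left _ _
lemma cut_le_one {d : ℕ} (x₀ : Eu d) (R : ℝ) (x : Eu d) : cut x₀ R x ≤ 1 :=
  max_le zero_le_one (min_le_left _ _)
lemma cut_one {d : ℕ} {x₀ : Eu d} {R : ℝ} (hR : 0 < R) {x : Eu d} (h : ‖x - x₀‖ ≤ R) : cut x₀ R x = 1 := by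
  have : ‖x - x₀‖ / R ≤ 1 := by rwa [div_le_one hR]
  unfold cut
  rw [min_eq_left (by linarith), max_eq_right (by norm_num)]
lemma cut_zero {d : ℕ} {x₀ : Eu d} {R : ℝ} (hR : 0 < R) {x : Eu d} (h : 2 * R ≤ ‖x - x₀‖) : cut x₀ R x = 0 := by
  have : 2 ≤ ‖x - x₀‖ / R := by rwa [le_div_iff₀ hR]
  unfold cut
  rw [min_eq_right (by linarith), max_eq_left (by linarith)]
lemma cut_lip {d : ℕ} (x₀ : Eu d) {R : ℝ} (hR : 0 < R) (x y : Eu d) :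
    |cut x₀ R x - cut x₀ R y| ≤ ‖x - y‖ / R := by
  unfold cut
  have h1 := abs_max_sub_max_le_max 0 (min 1 (2 - ‖x - x₀‖ / R)) 0 (min 1 (2 - ‖y - x₀‖ / R))
  have h2 := abs_min_sub_min_le_max 1 (2 - ‖x - x₀‖ / R) 1 (2 - ‖y - x₀‖ / R)
  simp only [sub_self, abs_zero, abs_nonneg, sup_of_le_right] at h1 h2
  refine h1.trans (h2.trans ?_)
  rw [show 2 - ‖x - x₀‖ / R - (2 - ‖y - x₀‖ / R) = (‖y - x₀‖ - ‖x - x₀‖) / R by ring, abs_div, abs_of_pos hR]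
  gcongr
  have := abs_norm_sub_norm_le (y - x₀) (x - x₀)
  rwa [sub_sub_sub_cancel_right, norm_sub_rev y x] at this

lemma cut_LC {d : ℕ} (x₀ : Eu d) {R : ℝ} (hR : 1 ≤ R) : LC 1 (‖x₀‖ + 2 * R) (cut x₀ R) := by
  refine ⟨zero_le_one, fun x y => ?_, fun x => ?_, fun x hx => ?_⟩
  · refine (cut_lip x₀ (by linarith) x y).trans ?_
    rw [one_mul]; exact div_le_self (norm_nonneg _) hR
  · rw [abs_of_nonneg (cut_nonneg _ _ _)]; exact cut_le_one _ _ _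
  · apply cut_zero (by linarith)
    have := norm_sub_norm_le x x₀
    linarith

lemma cut_cont {d : ℕ} (x₀ : Eu d) {R : ℝ} (hR : 1 ≤ R) : Continuous (cut x₀ R) := (cut_LC x₀ hR).continuous

lemma k_diff {p h m m' : ℝ} (hp : 0 < p) (hm : 0 < m) (h1 : |m - m'| ≤ h) (h2 : m ≤ 2 * m') :
    |m' ^ (-p) - m ^ (-p)| ≤ p * 2 ^ (p+1) * h * m ^ (-p-1) := by
  have hder : ∀ t ∈ Ici (m/2), HasDerivWithinAt (fun t : ℝ => t ^ (-p)) (-p * t ^ (-p-1)) (Ici (m/2)) t := by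
    intro t ht
    have ht0 : t ≠ 0 := by have : m/2 ≤ t := ht; linarith
    exact (Real.hasDerivAt_rpow_const (Or.inl ht0)).hasDerivWithinAt
  have hbd : ∀ t ∈ Ici (m/2), ‖-p * t ^ (-p-1)‖ ≤ p * 2 ^ (p+1) * m ^ (-p-1) := by
    intro t ht
    have ht' : m/2 ≤ t := ht
    have ht0 : 0 < t := by linarith
    rw [norm_mul, norm_neg, Real.norm_of_nonneg hp.le, Real.norm_of_nonneg (by positivity), mul_assoc]
    gcongr
    calc t ^ (-p-1) ≤ (m/2) ^ (-p-1) := Real.rpow_le_rpow_of_nonpos (by positivity) ht' (by linarith)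
      _ = 2 ^ (p+1) * m ^ (-p-1) := by
        rw [Real.div_rpow hm.le (by norm_num), div_eq_mul_inv, ← Real.rpow_neg (by norm_num), mul_comm]
        congr 2; ring
  have := (convex_Ici (m/2)).norm_image_sub_le_of_norm_hasDerivWithin_le hder hbd (x := m) (y := m')
    (by simp; linarith) (by simp; linarith)
  rw [Real.norm_eq_abs, Real.norm_eq_abs] at this
  refine this.trans ?_
  rw [abs_sub_comm] at h1
  calc _ ≤ p * 2 ^ (p+1) * m ^ (-p-1) * h := by gcongr
    _ = _ := by ring

lemma g_diff {p h R m m' a a' q q' : ℝ} (hp : 0 < p) (hh : 0 < h) (hR : 0 < R) (hm : 0 < m) (hm' : 0 < m')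
    (h1 : |m - m'| ≤ h) (h2 : m ≤ 2 * m') (h3 : m' ≤ 2 * m)
    (ha : |a| ≤ min (m/R) 1) (ha' : |a'| ≤ min (m'/R) 1) (haa : |a' - a| ≤ h/R)
    (hq : |q| ≤ 2) (hq' : |q'| ≤ 2) (hqq : |q' - q| ≤ h/R) :
    |a'^2 * q' * m' ^ (-p) - a^2 * q * m ^ (-p)| ≤ (7 + 4 * p) * 2 ^ p * (h/R) * (min (m/R) 1 * m ^ (-p)) := by
  set μ := min (m/R) 1 with hμ
  have hμ0 : 0 ≤ μ := by positivity
  have hμ1 : μ ≤ 1 := min_le_right _ _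
  have hμm : μ ≤ m/R := min_le_left _ _
  have ha2 : |a'| ≤ 2 * μ := by
    refine ha'.trans ?_
    rw [hμ]
    rcases min_cases (m/R) 1 with ⟨e, _⟩ | ⟨e, _⟩ <;> rw [e]
    · refine (min_le_left _ _).trans ?_
      rw [← mul_div_assoc]; gcongr
    · exact (min_le_right _ _).trans (by norm_num)
  have hk := k_diff hp hm h1 h2
  have hk' : m' ^ (-p) ≤ 2 ^ p * m ^ (-p) := by
    calc m' ^ (-p) ≤ (m/2) ^ (-p) := Real.rpow_le_rpow_of_nonpos (by positivity) (by linarith) (by linarith)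
      _ = _ := by
        rw [Real.div_rpow hm.le (by norm_num), div_eq_mul_inv, ← Real.rpow_neg (by norm_num), mul_comm]
        congr 2; ring
  have hk'0 : 0 ≤ m' ^ (-p) := by positivity
  have hhR : 0 ≤ h/R := by positivity
  have e : a'^2 * q' * m' ^ (-p) - a^2 * q * m ^ (-p) =
      ((a' - a) * (a' + a)) * q' * m' ^ (-p) + a^2 * (q' - q) * m' ^ (-p) + a^2 * q * (m' ^ (-p) - m ^ (-p)) := by ring
  have t1 : |((a' - a) * (a' + a)) * q' * m' ^ (-p)| ≤ ((h/R) * (3 * μ)) * 2 * (2 ^ p * m ^ (-p)) := by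
    rw [abs_mul, abs_mul, abs_mul, abs_of_nonneg hk'0]
    have : |a' + a| ≤ 3 * μ := (abs_add_le _ _).trans (by linarith)
    gcongr
  have hsq : |a^2| ≤ μ * μ := by
    rw [abs_pow, sq]; gcongr
  have t2 : |a^2 * (q' - q) * m' ^ (-p)| ≤ (μ * 1) * (h/R) * (2 ^ p * m ^ (-p)) := by
    rw [abs_mul, abs_mul, abs_of_nonneg hk'0]
    have : |a^2| ≤ μ * 1 := hsq.trans (by gcongr)
    gcongr
  have t3 : |a^2 * q * (m' ^ (-p) - m ^ (-p))| ≤ (μ * (m/R)) * 2 * (p * 2 ^ (p+1) * h * m ^ (-p-1)) := by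
    rw [abs_mul, abs_mul]
    have : |a^2| ≤ μ * (m/R) := hsq.trans (by gcongr)
    gcongr
  have t3' : (μ * (m/R)) * 2 * (p * 2 ^ (p+1) * h * m ^ (-p-1)) = μ * (h/R) * (4 * p * 2 ^ p) * m ^ (-p) := by
    rw [Real.rpow_sub_one hm.ne', Real.rpow_add_one (by norm_num)]
    field_simp
    ring
  rw [e]
  refine (abs_add_three _ _ _).trans ?_
  rw [t3'] at t3
  refine (add_le_add (add_le_add t1 t2) t3).trans (le_of_eq ?_)
  ring

lemma pt_small {p h R CH β n a q W : ℝ} (hR : 1 ≤ R) (hh : 0 < h) (hp : 0 < p) (hn : 0 ≤ n) (hCH : 0 ≤ CH)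
    (ha : |a| ≤ n / R) (hq : |q| ≤ 2) (hW : |W| ≤ CH * h ^ β) :
    ‖W * (a ^ 2 * q * ((n ^ p)⁻¹ - (max n h) ^ (-p)))‖ ≤
      2 * CH * h ^ β * (R ^ 2)⁻¹ * (if n < h then n ^ (2 - p) else 0) := by
  have hR0 : 0 < R := by linarith
  split_ifs with hlt
  · rcases hn.eq_or_lt with h0 | h0
    · subst h0
      have : a = 0 := by simpa using ha
      rw [this]; simp; positivity
    · have e1 : |(n ^ p)⁻¹ - (max n h) ^ (-p)| ≤ n ^ (-p) := by
        rw [← Real.rpow_neg hn]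
        have : (max n h) ^ (-p) ≤ n ^ (-p) := Real.rpow_le_rpow_of_nonpos h0 (le_max_left _ _) (by linarith)
        have h2 : 0 ≤ (max n h) ^ (-p) := by positivity
        rw [abs_of_nonneg (by linarith)]; linarith
      have e2 : |a ^ 2| ≤ (n/R) ^ 2 := by rw [abs_pow]; gcongr
      rw [Real.norm_eq_abs, abs_mul, abs_mul, abs_mul]
      calc _ ≤ (CH * h ^ β) * ((n/R) ^ 2 * 2 * n ^ (-p)) := by gcongr
        _ = _ := by
          rw [sub_eq_add_neg, Real.rpow_add h0, Real.rpow_two]; field_simp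
  · rw [max_eq_left (not_lt.mp hlt), Real.rpow_neg hn, sub_self]; simp

lemma pt_large {dd p h R CH β n D : ℝ} (hR : 1 ≤ R) (hh : 0 < h) (hh1 : h ≤ 1) (hp : dd + 1 ≤ p) (hp1 : 1 ≤ p) (hn : 0 ≤ n) (hCH : 0 ≤ CH)
    (hβ : 0 < β)
    (hD : |D| ≤ 2) (hD' : |D| ≤ CH * n ^ β) :
    |D| * (min (max n h / R) 1 * (max n h) ^ (-p)) ≤ R⁻¹ *
      (CH * (if n < 1 then n ^ (β + 1 - p) else 0) + 2 * (if 1 ≤ n ∧ n ≤ R then n ^ (-dd) else 0)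
        + 2 * R * (if R < n then n ^ (-p) else 0)) := by
  have hR0 : 0 < R := by linarith
  by_cases h1 : n < 1
  · rw [if_pos h1, if_neg (by intro h; linarith [h.1]), if_neg (by linarith)]
    rcases hn.eq_or_lt with h0 | h0
    · subst h0
      rw [Real.zero_rpow hβ.ne', mul_zero] at hD'
      have : |D| = 0 := le_antisymm hD' (abs_nonneg _)
      rw [this, zero_mul]; positivity
    · set m := max n h
      have hm0 : 0 < m := by positivity
      have hmn : n ≤ m := le_max_left _ _
      calc |D| * (min (m / R) 1 * m ^ (-p)) ≤ (CH * n ^ β) * (m / R * m ^ (-p)) := by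
            gcongr; exact min_le_left _ _
        _ = (CH * n ^ β) * (R⁻¹ * m ^ (1 - p)) := by
            rw [sub_eq_add_neg, Real.rpow_add hm0, Real.rpow_one]; ring
        _ ≤ (CH * n ^ β) * (R⁻¹ * n ^ (1 - p)) := by
            have := Real.rpow_le_rpow_of_nonpos h0 hmn (by linarith : 1 - p ≤ 0)
            gcongr
        _ = _ := by rw [add_sub_assoc, Real.rpow_add h0]; ring
  · have h1 := not_lt.mp h1
    have hm : max n h = n := max_eq_left (by linarith)
    have hn0 : 0 < n := by linarith
    rw [hm, if_neg (by linarith)]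
    by_cases h2 : n ≤ R
    · rw [if_pos ⟨h1, h2⟩, if_neg (by linarith)]
      calc |D| * (min (n / R) 1 * n ^ (-p)) ≤ 2 * (n / R * n ^ (-p)) := by gcongr; exact min_le_left _ _
        _ = 2 * R⁻¹ * n ^ (1 - p) := by
            rw [sub_eq_add_neg, Real.rpow_add hn0, Real.rpow_one]; ring
        _ ≤ 2 * R⁻¹ * n ^ (-dd) := by
            have := Real.rpow_le_rpow_of_exponent_le h1 (by linarith : 1 - p ≤ -dd)
            gcongr
        _ = _ := by ring
    · rw [if_neg (by tauto), if_pos (by linarith)]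
      calc |D| * (min (n / R) 1 * n ^ (-p)) ≤ 2 * (1 * n ^ (-p)) := by gcongr; exact min_le_right _ _
        _ = _ := by field_simp; ring

set_option maxHeartbeats 1000000 in
lemma inner_F {d : ℕ} (hd : 1 ≤ d) {s : ℝ} (hs0 : 1/2 ≤ s) (hs1 : s < 1) {β CH : ℝ} (hβ : 0 < β) (hβ0 : 2 * s - 1 < β)
    (hCH : 0 ≤ CH) :
    ∃ C : ℝ, 0 ≤ C ∧ ∀ u : Eu d → ℝ, Continuous u → (∀ x, |u x| ≤ 1) → (∀ x y, |u x - u y| ≤ CH * ‖x - y‖ ^ β) →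
      ∀ (v : Eu d) (h : ℝ), 0 < h → h ≤ 1 → ‖v‖ = h → ∀ (x₀ : Eu d) (R : ℝ), 1 ≤ R → ∀ x : Eu d,
      |∫ y, (u (y + v) - u y) * ((cut x₀ R x - cut x₀ R y) ^ 2 * (2 - cut x₀ (2 * R) y) * (‖x - y‖ ^ ((d : ℝ) + 2*s))⁻¹)| ≤
        C * (h * (R ^ 2)⁻¹ * (1 + Real.log R)) := by
  set p : ℝ := (d : ℝ) + 2*s with hp
  have hd1 : (1 : ℝ) ≤ d := by exact_mod_cast hd
  have hp0 : 0 < p := by rw [hp]; linarith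
  set V : ℝ := d * volume.real (ball (0 : Eu d) 1) with hV
  have hV0 : 0 ≤ V := by positivity
  set G : ℝ := (7 + 4 * p) * 2 ^ p with hG
  have hG0 : 0 ≤ G := by positivity
  have hβs : 0 < β + 1 - 2 * s := by linarith
  have hss : 0 < 2 - 2 * s := by linarith
  refine ⟨2 * CH * (V * (1 / (2 - 2*s))) + G * (V * (CH / (β + 1 - 2 * s) + 2)), by positivity, ?_⟩
  intro u huc hub huH v h hh hh1 hv x₀ R hR x
  have hR0 : 0 < R := by linarith
  have hlog : 0 ≤ Real.log R := Real.log_nonneg hR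
  set φ := cut x₀ R
  set χ := cut x₀ (2 * R)
  have hφc : Continuous φ := cut_cont x₀ hR
  have hχc : Continuous χ := cut_cont x₀ (by linarith)
  set k : Eu d → ℝ := fun z => (max ‖z‖ h) ^ (-p) with hk
  set g : Eu d → ℝ := fun y => (φ x - φ y) ^ 2 * (2 - χ y) * k (x - y) with hg
  set A : Eu d → ℝ := fun y => (u (y + v) - u y) * ((φ x - φ y) ^ 2 * (2 - χ y) * ((‖x - y‖ ^ p)⁻¹ - k (x - y))) with hA
  have hkc : Measurable k := by rw [hk]; fun_prop
  have hum := huc.measurable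
  have hφm := hφc.measurable
  have hχm := hχc.measurable
  have hgm : Measurable g := by rw [hg]; fun_prop
  have hq : ∀ y, |2 - χ y| ≤ 2 := fun y => by
    have h1 : 0 ≤ χ y := cut_nonneg _ _ _
    have h2 : χ y ≤ 1 := cut_le_one _ _ _
    rw [abs_le]; constructor <;> linarith
  have ha1 : ∀ y, |φ x - φ y| ≤ 1 := fun y => by
    have h1 : 0 ≤ φ y := cut_nonneg _ _ _
    have h2 : φ y ≤ 1 := cut_le_one _ _ _
    have h3 : 0 ≤ φ x := cut_nonneg _ _ _
    have h4 : φ x ≤ 1 := cut_le_one _ _ _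
    rw [abs_le]; constructor <;> linarith
  have haR : ∀ y, |φ x - φ y| ≤ ‖x - y‖ / R := fun y => cut_lip x₀ hR0 x y
  -- part A
  have bA : ∀ y, ‖A y‖ ≤ 2 * CH * h ^ β * (R ^ 2)⁻¹ * (if ‖x - y‖ < h then ‖x - y‖ ^ (2 - p) else 0) := by
    intro y
    refine pt_small hR hh hp0 (norm_nonneg _) hCH (haR y) (hq y) ?_
    have := huH (y + v) y
    rwa [add_sub_cancel_left, hv] at this
  obtain ⟨iS, eS⟩ := radial_pow_small hd (2 - p) (by rw [hp]; linarith) h hh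
  have iS' := (iS.comp_sub_left x).const_mul (2 * CH * h ^ β * (R ^ 2)⁻¹)
  have iA : Integrable A := iS'.mono' (by
    refine Measurable.aestronglyMeasurable ?_
    rw [hA]; fun_prop) (Filter.Eventually.of_forall bA)
  have IA : |∫ y, A y| ≤ 2 * CH * (V * (1 / (2 - 2*s))) * (h * (R ^ 2)⁻¹ * (1 + Real.log R)) := by
    have := norm_integral_le_of_norm_le iS' (Filter.Eventually.of_forall bA)
    rw [Real.norm_eq_abs, integral_const_mul,
      integral_sub_left_eq_self (fun z : Eu d => if ‖z‖ < h then ‖z‖ ^ (2 - p) else 0) volume x, eS] at this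
    refine this.trans ?_
    have e : 2 - p + d = 2 - 2 * s := by rw [hp]; ring
    rw [e]
    have hhh : h ^ β * h ^ (2 - 2 * s) ≤ h := by
      rw [← Real.rpow_add hh]
      calc h ^ (β + (2 - 2*s)) ≤ h ^ (1:ℝ) := Real.rpow_le_rpow_of_exponent_ge hh hh1 (by linarith)
        _ = h := Real.rpow_one h
    calc 2 * CH * h ^ β * (R ^ 2)⁻¹ * (↑d * volume.real (ball (0 : Eu d) 1) * (h ^ (2 - 2 * s) / (2 - 2 * s)))
        = 2 * CH * (V * (1 / (2 - 2*s))) * ((h ^ β * h ^ (2 - 2 * s)) * (R ^ 2)⁻¹ * 1) := by rw [hV]; ring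
      _ ≤ _ := by gcongr; linarith
  -- part B
  have bg : ∀ y, ‖g y‖ ≤ 2 * tker d s (x - y) := by
    intro y
    rw [hg, Real.norm_eq_abs, abs_mul, abs_mul, abs_pow]
    rcases (norm_nonneg (x - y)).eq_or_lt with h0 | h0
    · have := haR y
      rw [← h0, zero_div] at this
      have h00 : |φ x - φ y| = 0 := le_antisymm this (abs_nonneg _)
      rw [h00]; simp; exact tker_nonneg _ _ _
    · have hk1 : |k (x - y)| ≤ (‖x - y‖ ^ p)⁻¹ := by
        rw [hk, abs_of_nonneg (by positivity), ← Real.rpow_neg (norm_nonneg _)]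
        exact Real.rpow_le_rpow_of_nonpos h0 (le_max_left _ _) (by linarith)
      have hsq : |φ x - φ y| ^ 2 ≤ min (‖x - y‖ ^ 2) 1 := by
        refine le_min ?_ ?_
        · have : |φ x - φ y| ≤ ‖x - y‖ := (haR y).trans (div_le_self (norm_nonneg _) hR)
          gcongr
        · exact pow_le_one₀ (abs_nonneg _) (ha1 y)
      calc _ ≤ min (‖x - y‖ ^ 2) 1 * 2 * (‖x - y‖ ^ p)⁻¹ := by gcongr; exact hq y
        _ = _ := by unfold tker; rw [hp]; ring
  have ig : Integrable g := (((tker_integrable hd hs0 hs1).comp_sub_left x).const_mul 2).mono' hgm.aestronglyMeasurable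
    (Filter.Eventually.of_forall bg)
  have ig' : Integrable (fun y => g (y - v)) := ig.comp_sub_right v
  have iug : Integrable (fun y => u y * g y) := ig.bdd_mul hum.aestronglyMeasurable (c := 1) (Filter.Eventually.of_forall hub)
  have iug' : Integrable (fun y => u y * g (y - v)) := ig'.bdd_mul hum.aestronglyMeasurable (c := 1) (Filter.Eventually.of_forall hub)
  have iuvg : Integrable (fun y => u (y + v) * g y) := by
    have := iug'.comp_add_right v
    simpa using this
  have eB : ∫ y, (u (y + v) - u y) * g y = ∫ y, (u y - u x) * (g (y - v) - g y) := by
    have e1 : ∫ y, (u (y + v) - u y) * g y = (∫ y, u y * g (y - v)) - ∫ y, u y * g y := by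
      rw [← integral_add_right_eq_self (fun y => u y * g (y - v)) v]
      simp only [add_sub_cancel_right]
      rw [← integral_sub iuvg iug]
      congr 1; ext y; ring
    have e2 : ∫ y, (u y - u x) * (g (y - v) - g y) =
        ((∫ y, u y * g (y - v)) - ∫ y, u y * g y) - u x * ((∫ y, g (y - v)) - ∫ y, g y) := by
      have j1 : Integrable (fun y => u y * g (y - v) - u y * g y) := iug'.sub iug
      have j2 : Integrable (fun y => u x * (g (y - v) - g y)) := (ig'.sub ig).const_mul _
      rw [← integral_sub iug' iug, ← integral_sub ig' ig, ← integral_const_mul, ← integral_sub j1 j2]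
      congr 1; ext y; ring
    rw [e1, e2, integral_sub_right_eq_self g v]; ring
  set F2 : Eu d → ℝ := fun z => (CH * (if ‖z‖ < 1 then ‖z‖ ^ (β + 1 - p) else 0) + 2 * (if 1 ≤ ‖z‖ ∧ ‖z‖ ≤ R then ‖z‖ ^ (-(d:ℝ)) else 0)
        + 2 * R * (if R < ‖z‖ then ‖z‖ ^ (-p) else 0)) with hF2
  obtain ⟨i1, e1⟩ := radial_pow_small hd (β + 1 - p) (by rw [hp]; linarith) 1 one_pos
  obtain ⟨i2, e2⟩ := radial_log hd R hR
  obtain ⟨i3, e3⟩ := radial_pow_large hd (-p) (by rw [hp]; linarith) R hR0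
  have iF2 : Integrable F2 := ((i1.const_mul CH).add (i2.const_mul 2)).add (i3.const_mul (2 * R))
  have eF2 : ∫ z, F2 z ≤ V * (CH / (β + 1 - 2 * s) + 2) * (1 + Real.log R) := by
    have : ∫ z, F2 z = CH * (V * (1 / (β + 1 - 2*s))) + 2 * (V * Real.log R) + 2 * R * (V * (R ^ (-(2*s)) / (2*s))) := by
      have j1 : Integrable (fun z : Eu d => CH * (if ‖z‖ < 1 then ‖z‖ ^ (β + 1 - p) else 0) + 2 * (if 1 ≤ ‖z‖ ∧ ‖z‖ ≤ R then ‖z‖ ^ (-(d:ℝ)) else 0)) :=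
        (i1.const_mul CH).add (i2.const_mul 2)
      rw [hF2, integral_add j1 (i3.const_mul (2 * R)),
        integral_add (i1.const_mul CH) (i2.const_mul 2), integral_const_mul, integral_const_mul, integral_const_mul, e1, e2, e3, Real.one_rpow]
      rw [show β + 1 - p + d = β + 1 - 2 * s by rw [hp]; ring, show -p + d = -(2*s) by rw [hp]; ring, neg_neg]
    rw [this]
    have hRR : R * (R ^ (-(2*s)) / (2*s)) ≤ 1 := by
      have h1 : R ^ (-(2*s)) ≤ R ^ (-1 : ℝ) := Real.rpow_le_rpow_of_exponent_le hR (by linarith)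
      rw [Real.rpow_neg_one] at h1
      calc R * (R ^ (-(2*s)) / (2*s)) ≤ R * (R⁻¹ / 1) := by gcongr; linarith
        _ = 1 := by field_simp
    have hq0 : 0 ≤ CH / (β + 1 - 2*s) := by positivity
    have : 2 * R * (V * (R ^ (-(2*s)) / (2*s))) ≤ 2 * V := by nlinarith
    have : 0 ≤ CH / (β + 1 - 2*s) * V * Real.log R := by positivity
    have e : CH * (V * (1 / (β + 1 - 2*s))) = CH / (β + 1 - 2*s) * V := by ring
    rw [e]; nlinarith
  have bB : ∀ y, ‖(u y - u x) * (g (y - v) - g y)‖ ≤ G * (h / R) * R⁻¹ * F2 (x - y) := by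
    intro y
    rw [Real.norm_eq_abs, abs_mul]
    have hD : |u y - u x| ≤ 2 := by
      have := abs_sub (u y) (u x); linarith [hub x, hub y]
    have hD' : |u y - u x| ≤ CH * ‖x - y‖ ^ β := by rw [norm_sub_rev]; exact huH y x
    have hl := pt_large (dd := d) (p := p) hR hh hh1 (by rw [hp]; linarith) (by rw [hp]; linarith) (norm_nonneg (x - y)) hCH hβ hD hD'
    have hmm : |max ‖x - y‖ h - max ‖x - (y - v)‖ h| ≤ h := by
      refine (abs_max_sub_max_le_abs _ _ _).trans ?_
      have := abs_norm_sub_norm_le (x - y) (x - (y - v))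
      rwa [show x - y - (x - (y - v)) = -v by abel, norm_neg, hv] at this
    have hmm2 := abs_le.mp hmm
    have hmh : h ≤ max ‖x - y‖ h := le_max_right _ _
    have hmh' : h ≤ max ‖x - (y - v)‖ h := le_max_right _ _
    have hamin : ∀ w, |φ x - φ w| ≤ min (max ‖x - w‖ h / R) 1 := fun w => by
      refine le_min ((haR w).trans ?_) (ha1 w)
      gcongr; exact le_max_left _ _
    have hgd := g_diff (p := p) (h := h) (R := R) (m := max ‖x - y‖ h) (m' := max ‖x - (y - v)‖ h)
      (a := φ x - φ y) (a' := φ x - φ (y - v)) (q := 2 - χ y) (q' := 2 - χ (y - v)) hp0 hh hR0 (by linarith) (by linarith)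
      hmm (by linarith) (by linarith) (hamin y) (hamin (y - v))
      (by
        rw [show φ x - φ (y - v) - (φ x - φ y) = φ y - φ (y - v) by ring]
        have := cut_lip x₀ hR0 y (y - v)
        rwa [sub_sub_cancel, hv] at this)
      (hq y) (hq (y - v))
      (by
        rw [show 2 - χ (y - v) - (2 - χ y) = χ y - χ (y - v) by ring]
        have := cut_lip x₀ (by linarith : 0 < 2 * R) y (y - v)
        rw [sub_sub_cancel, hv] at this
        refine this.trans ?_
        gcongr; linarith)
    calc |u y - u x| * |g (y - v) - g y| ≤ |u y - u x| * (G * (h/R) * (min (max ‖x - y‖ h / R) 1 * (max ‖x - y‖ h) ^ (-p))) := by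
          gcongr
      _ = G * (h/R) * (|u y - u x| * (min (max ‖x - y‖ h / R) 1 * (max ‖x - y‖ h) ^ (-p))) := by ring
      _ ≤ G * (h/R) * (R⁻¹ * F2 (x - y)) := by gcongr
      _ = _ := by ring
  have IB : |∫ y, (u (y + v) - u y) * g y| ≤ G * (V * (CH / (β + 1 - 2 * s) + 2)) * (h * (R ^ 2)⁻¹ * (1 + Real.log R)) := by
    rw [eB]
    have := norm_integral_le_of_norm_le ((iF2.comp_sub_left x).const_mul (G * (h / R) * R⁻¹)) (Filter.Eventually.of_forall bB)
    rw [Real.norm_eq_abs, integral_const_mul, integral_sub_left_eq_self F2 volume x] at this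
    refine this.trans ?_
    calc _ ≤ G * (h / R) * R⁻¹ * (V * (CH / (β + 1 - 2 * s) + 2) * (1 + Real.log R)) := by gcongr
      _ = _ := by field_simp
  have eT : ∫ y, (u (y + v) - u y) * ((φ x - φ y) ^ 2 * (2 - χ y) * (‖x - y‖ ^ p)⁻¹) =
      (∫ y, A y) + ∫ y, (u (y + v) - u y) * g y := by
    rw [← integral_add iA (by
      have := iuvg.sub iug
      refine this.congr (Filter.Eventually.of_forall fun y => ?_)
      simp only [Pi.sub_apply]; ring)]
    congr 1; ext y; rw [hA, hg]; ring
  rw [eT, add_mul]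
  exact (abs_add_le _ _).trans (add_le_add IA IB)

lemma LC_mul {d : ℕ} {L r K : ℝ} {φ w : Eu d → ℝ} (h : LC L r φ) (hK : 0 ≤ K)
    (hw : ∀ x y : Eu d, (‖x‖ ≤ r ∨ ‖y‖ ≤ r) → |w x - w y| ≤ K * min ‖x - y‖ 1) (hw2 : ∀ x, |w x| ≤ 2) :
    LC (L * (K + 2)) r (fun x => φ x * w x) := by
  obtain ⟨h0, h1, h2, h3⟩ := h
  refine ⟨by positivity, fun x y => ?_, fun x => ?_, fun x hx => by simp only [h3 x hx, zero_mul]⟩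
  · by_cases hxy : ‖x‖ ≤ r ∨ ‖y‖ ≤ r
    · have hd := hw x y hxy
      have hd' : |w x - w y| ≤ K * ‖x - y‖ := hd.trans (by gcongr; exact min_le_left _ _)
      have e : φ x * w x - φ y * w y = (φ x - φ y) * w x + φ y * (w x - w y) := by ring
      simp only [e]
      refine (abs_add_le _ _).trans ?_
      rw [abs_mul, abs_mul]
      calc _ ≤ (L * ‖x - y‖) * 2 + L * (K * ‖x - y‖) := by
            gcongr
            · exact h1 x y
            · exact hw2 x
            · exact h2 y
        _ = _ := by ring
    · push Not at hxy
      simp only [h3 x hxy.1, h3 y hxy.2, zero_mul, sub_self, abs_zero]; positivity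
  · rw [abs_mul]
    calc |φ x| * |w x| ≤ L * (K + 2) := by
          have := h2 x
          have := hw2 x
          gcongr
          linarith

lemma mvt_holder {f f' : ℝ → ℝ} {α Cα : ℝ} (hα : 0 < α) (hder : ∀ x ∈ Set.Icc (-1 : ℝ) 1, HasDerivAt f (f' x) x)
    (hC : 0 ≤ Cα) (hH : ∀ x ∈ Set.Icc (-1 : ℝ) 1, ∀ y ∈ Set.Icc (-1 : ℝ) 1, |f' x - f' y| ≤ Cα * |x - y| ^ α)
    {a b : ℝ} (ha : a ∈ Icc (-1:ℝ) 1) (hb : b ∈ Icc (-1:ℝ) 1) :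
    |f b - f a - f' a * (b - a)| ≤ Cα * |b - a| ^ α * |b - a| := by
  have hsub : uIcc a b ⊆ Icc (-1:ℝ) 1 := uIcc_subset_Icc ha hb
  have h1 : ∀ t ∈ uIcc a b, HasDerivWithinAt (fun t => f t - f' a * t) (f' t - f' a) (uIcc a b) t := by
    intro t ht
    have : HasDerivAt (fun t => f t - f' a * t) (f' t - f' a * 1) t :=
      (hder t (hsub ht)).sub ((hasDerivAt_id t).const_mul (f' a))
    rw [mul_one] at this
    exact this.hasDerivWithinAt
  have h2 : ∀ t ∈ uIcc a b, ‖f' t - f' a‖ ≤ Cα * |b - a| ^ α := by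
    intro t ht
    refine (hH t (hsub ht) a ha).trans ?_
    have := abs_sub_left_of_mem_uIcc ht
    gcongr
  have := (convex_uIcc a b).norm_image_sub_le_of_norm_hasDerivWithin_le h1 h2 left_mem_uIcc right_mem_uIcc
  rw [Real.norm_eq_abs, Real.norm_eq_abs] at this
  rwa [show f b - f' a * b - (f a - f' a * a) = f b - f a - f' a * (b - a) by ring] at this

lemma holder_contOn {f' : ℝ → ℝ} {α Cα : ℝ} (hα : 0 < α) 
    (hH : ∀ x ∈ Set.Icc (-1 : ℝ) 1, ∀ y ∈ Set.Icc (-1 : ℝ) 1, |f' x - f' y| ≤ Cα * |x - y| ^ α) :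
    ContinuousOn f' (Icc (-1:ℝ) 1) := by
  intro x hx
  rw [ContinuousWithinAt, tendsto_iff_dist_tendsto_zero]
  have h0 : Filter.Tendsto (fun y : ℝ => Cα * |y - x| ^ α) (nhdsWithin x (Icc (-1:ℝ) 1)) (nhds 0) := by
    have : Continuous (fun y : ℝ => Cα * |y - x| ^ α) := by
      refine continuous_const.mul (Continuous.rpow_const (by fun_prop) (fun _ => Or.inr hα.le))
    have h := this.tendsto x
    simp only [sub_self, abs_zero, Real.zero_rpow hα.ne', mul_zero] at h
    exact h.mono_left nhdsWithin_le_nhds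
  refine squeeze_zero' (Filter.Eventually.of_forall fun _ => dist_nonneg) ?_ h0
  filter_upwards [self_mem_nhdsWithin] with y hy
  rw [Real.dist_eq]
  exact hH y hy x hx

/-- data of a stable solution -/
structure Sol (d : ℕ) (s c : ℝ) (f f' : ℝ → ℝ) (α Cα : ℝ) (u : Eu d → ℝ) : Prop where
  hd : 1 ≤ d
  hs0 : 1/2 ≤ s
  hs1 : s < 1
  hc : 0 < c
  hα : 0 < α
  hder : ∀ x ∈ Set.Icc (-1 : ℝ) 1, HasDerivAt f (f' x) x
  hC : 0 ≤ Cα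
  hH : ∀ x ∈ Set.Icc (-1 : ℝ) 1, ∀ y ∈ Set.Icc (-1 : ℝ) 1, |f' x - f' y| ≤ Cα * |x - y| ^ α
  hu : ContDiff ℝ 2 u
  hb : ∀ x, |u x| ≤ 1
  heq : ∀ x : Eu d, c * ∫ y : Eu d, (2 * u x - u (x + y) - u (x - y)) / ‖y‖ ^ ((d : ℝ) + 2*s) = f (u x)
  hst : ∀ η : Eu d → ℝ, ContDiff ℝ (⊤ : ℕ∞) η → HasCompactSupport η →
    ∫ x : Eu d, f' (u x) * (η x)^2 ≤ c * ∫ x : Eu d, ∫ y : Eu d, (η x - η y)^2 / ‖x - y‖ ^ ((d : ℝ) + 2*s)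

lemma mainD {d : ℕ} {s c : ℝ} {f f' : ℝ → ℝ} {α Cα : ℝ} {u : Eu d → ℝ} (H : Sol d s c f f' α Cα u)
    {W : Eu d → ℝ} {v : Eu d} (hW : ∀ x, W x = u (x + v) - u x) {b : ℝ} (hb0 : 0 < b) (hWb : ∀ x, |W x| ≤ b)
    (x₀ : Eu d) {R : ℝ} (hR : 1 ≤ R) :
    Integrable (fun q : Eu d × Eu d => W q.1 * W q.2 * (cut x₀ R q.1 - cut x₀ R q.2) ^ 2 / ‖q.1 - q.2‖ ^ ((d:ℝ) + 2*s)) (volume.prod volume) ∧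
    Integrable (fun q : Eu d × Eu d => cut x₀ R q.1 * cut x₀ R q.2 * (|W q.1 * W q.2| - W q.1 * W q.2) / ‖q.1 - q.2‖ ^ ((d:ℝ) + 2*s)) (volume.prod volume) ∧
    2 * c * ∫ q : Eu d × Eu d, cut x₀ R q.1 * cut x₀ R q.2 * (|W q.1 * W q.2| - W q.1 * W q.2) / ‖q.1 - q.2‖ ^ ((d:ℝ) + 2*s) ∂(volume.prod volume)
      ≤ c * (∫ q : Eu d × Eu d, W q.1 * W q.2 * (cut x₀ R q.1 - cut x₀ R q.2) ^ 2 / ‖q.1 - q.2‖ ^ ((d:ℝ) + 2*s) ∂(volume.prod volume))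
        + Cα * b ^ (1 + α) * ∫ x, cut x₀ R x * |W x| := by
  obtain ⟨hd, hs0, hs1, hc, hα, hder, hC, hH, hu, hub, heq, hst⟩ := H
  set p : ℝ := (d:ℝ) + 2*s with hp
  set φ := cut x₀ R with hφ
  have hφL : LC 1 (‖x₀‖ + 2 * R) φ := cut_LC x₀ hR
  set r := ‖x₀‖ + 2 * R
  have hφc := hφL.continuous
  have hφ0 : ∀ x, 0 ≤ φ x := cut_nonneg _ _
  have hφ1 : ∀ x, φ x ≤ 1 := cut_le_one _ _
  set uv : Eu d → ℝ := fun x => u (x + v) with huv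
  have huvC : ContDiff ℝ 2 uv := hu.comp (contDiff_id.add contDiff_const)
  have huvb : ∀ x, |uv x| ≤ 1 := fun x => hub _
  have hWC : ContDiff ℝ 2 W := by
    rw [show W = fun x => uv x - u x from funext hW]
    exact huvC.sub hu
  have hW2 : ∀ x, |W x| ≤ 2 := fun x => by
    rw [hW]; have := abs_sub (u (x + v)) (u x); linarith [hub x, hub (x + v)]
  have hWc := hWC.continuous
  obtain ⟨K, hK0, hK⟩ := u_sub_le hWC (by norm_num) hW2 r
  have hηL : LC (1 * (K + 2)) r (fun x => φ x * |W x|) := LC_mul hφL hK0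
    (fun x y h => (abs_abs_sub_abs_le _ _).trans (hK x y h)) (fun x => by rw [abs_abs]; exact hW2 x)
  have hψ1 : LC (1 * (K + 2)) r (fun x => φ x * W x) := LC_mul hφL hK0 hK hW2
  have hψL := LC_mul hφL (K := 2 * (1 * (K + 2))) (by positivity) (fun x y _ => hψ1.sub_le x y) (fun x => by
    rw [abs_mul, abs_of_nonneg (hφ0 x)]
    calc φ x * |W x| ≤ 1 * 2 := by gcongr; exacts [hφ1 x, hW2 x]
      _ = 2 := by norm_num)
  -- integrable pieces
  have i1 := hηL.integrable_sq hd hs0 hs1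
  have i2 := form_integrable hd hs0 hs1 hWC (by norm_num) hW2 hψL
  have i2v := form_integrable hd hs0 hs1 huvC (by norm_num) huvb hψL
  have i2u := form_integrable hd hs0 hs1 hu (by norm_num) hub hψL
  have i3 : Integrable (fun q : Eu d × Eu d => W q.1 * W q.2 * (φ q.1 - φ q.2) ^ 2 / ‖q.1 - q.2‖ ^ p) (volume.prod volume) := by
    have i0 := hφL.integrable_sq hd hs0 hs1
    have := i0.bdd_mul (f := fun q : Eu d × Eu d => W q.1 * W q.2) (c := 4)
      (by exact (by fun_prop : Continuous _).aestronglyMeasurable) (Filter.Eventually.of_forall fun q => by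
        rw [norm_mul]
        calc ‖W q.1‖ * ‖W q.2‖ ≤ 2 * 2 := by gcongr; exacts [hW2 _, hW2 _]
          _ = 4 := by norm_num)
    refine this.congr (Filter.Eventually.of_forall fun q => ?_)
    simp only [mul_div_assoc]; rfl
  have hid : ∀ q : Eu d × Eu d, φ q.1 * φ q.2 * (|W q.1 * W q.2| - W q.1 * W q.2) / ‖q.1 - q.2‖ ^ p =
      (1/2) * (((φ q.1 * (φ q.1 * W q.1) - φ q.2 * (φ q.2 * W q.2)) * (W q.1 - W q.2) / ‖q.1 - q.2‖ ^ p
        + W q.1 * W q.2 * (φ q.1 - φ q.2) ^ 2 / ‖q.1 - q.2‖ ^ p)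
        - (φ q.1 * |W q.1| - φ q.2 * |W q.2|) ^ 2 / ‖q.1 - q.2‖ ^ p) := by
    intro q
    have a1 := sq_abs (W q.1)
    have a2 := sq_abs (W q.2)
    rw [abs_mul]
    have : φ q.1 * φ q.2 * (|W q.1| * |W q.2| - W q.1 * W q.2) = (1/2) * ((φ q.1 * (φ q.1 * W q.1) - φ q.2 * (φ q.2 * W q.2)) * (W q.1 - W q.2) + W q.1 * W q.2 * (φ q.1 - φ q.2) ^ 2
        - (φ q.1 * |W q.1| - φ q.2 * |W q.2|) ^ 2) := by
      linear_combination (1/2) * (φ q.1)^2 * a1 + (1/2) * (φ q.2)^2 * a2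
    rw [this]; ring
  have i23 : Integrable (fun q : Eu d × Eu d => (φ q.1 * (φ q.1 * W q.1) - φ q.2 * (φ q.2 * W q.2)) * (W q.1 - W q.2) / ‖q.1 - q.2‖ ^ p
        + W q.1 * W q.2 * (φ q.1 - φ q.2) ^ 2 / ‖q.1 - q.2‖ ^ p) (volume.prod volume) := i2.add i3
  have i4 : Integrable (fun q : Eu d × Eu d => φ q.1 * φ q.2 * (|W q.1 * W q.2| - W q.1 * W q.2) / ‖q.1 - q.2‖ ^ p) (volume.prod volume) := by
    simp only [hid]
    exact (i23.sub i1).const_mul _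
  refine ⟨i3, i4, ?_⟩
  have hI4 : ∫ q : Eu d × Eu d, φ q.1 * φ q.2 * (|W q.1 * W q.2| - W q.1 * W q.2) / ‖q.1 - q.2‖ ^ p ∂(volume.prod volume) =
      (1/2) * (((∫ q : Eu d × Eu d, (φ q.1 * (φ q.1 * W q.1) - φ q.2 * (φ q.2 * W q.2)) * (W q.1 - W q.2) / ‖q.1 - q.2‖ ^ p ∂(volume.prod volume))
        + ∫ q : Eu d × Eu d, W q.1 * W q.2 * (φ q.1 - φ q.2) ^ 2 / ‖q.1 - q.2‖ ^ p ∂(volume.prod volume))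
        - ∫ q : Eu d × Eu d, (φ q.1 * |W q.1| - φ q.2 * |W q.2|) ^ 2 / ‖q.1 - q.2‖ ^ p ∂(volume.prod volume)) := by
    simp only [hid]
    rw [integral_const_mul, integral_sub i23 i1, integral_add i2 i3]
  rw [hI4]
  -- weak forms
  have hmem : ∀ x, u x ∈ Icc (-1:ℝ) 1 := fun x => abs_le.mp (hub x)
  have hfc : ContinuousOn f (Icc (-1:ℝ) 1) := fun x hx => (hder x hx).continuousAt.continuousWithinAt
  have hfu : Continuous (fun x => f (u x)) := hfc.comp_continuous hu.continuous hmem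
  have hgu : Continuous (fun x => f' (u x)) := (holder_contOn hα hH).comp_continuous hu.continuous hmem
  have hfuv : Continuous (fun x => f (u (x + v))) := hfu.comp (by fun_prop)
  have wu := weak_form hd hs0 hs1 hu hub hψL
  have wv := weak_form hd hs0 hs1 huvC huvb hψL
  have hw2 : ∫ q : Eu d × Eu d, (φ q.1 * (φ q.1 * W q.1) - φ q.2 * (φ q.2 * W q.2)) * (W q.1 - W q.2) / ‖q.1 - q.2‖ ^ p ∂(volume.prod volume)
     = (∫ q : Eu d × Eu d, (φ q.1 * (φ q.1 * W q.1) - φ q.2 * (φ q.2 * W q.2)) * (uv q.1 - uv q.2) / ‖q.1 - q.2‖ ^ p ∂(volume.prod volume))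
      - ∫ q : Eu d × Eu d, (φ q.1 * (φ q.1 * W q.1) - φ q.2 * (φ q.2 * W q.2)) * (u q.1 - u q.2) / ‖q.1 - q.2‖ ^ p ∂(volume.prod volume) := by
    rw [← integral_sub i2v i2u]
    refine integral_congr_ae (Filter.Eventually.of_forall fun q => ?_)
    have e1 : W q.1 - W q.2 = (uv q.1 - uv q.2) - (u q.1 - u q.2) := by rw [hW, hW]; ring
    simp only [e1]; ring
  have cu : c * ∫ q : Eu d × Eu d, (φ q.1 * (φ q.1 * W q.1) - φ q.2 * (φ q.2 * W q.2)) * (u q.1 - u q.2) / ‖q.1 - q.2‖ ^ p ∂(volume.prod volume)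
      = ∫ x, φ x * (φ x * W x) * f (u x) := by
    rw [← wu, ← integral_const_mul]
    refine integral_congr_ae (Filter.Eventually.of_forall fun x => ?_)
    have := heq x
    simp only [← this]; ring
  have cv : c * ∫ q : Eu d × Eu d, (φ q.1 * (φ q.1 * W q.1) - φ q.2 * (φ q.2 * W q.2)) * (uv q.1 - uv q.2) / ‖q.1 - q.2‖ ^ p ∂(volume.prod volume)
      = ∫ x, φ x * (φ x * W x) * f (u (x + v)) := by
    rw [← wv, ← integral_const_mul]
    refine integral_congr_ae (Filter.Eventually.of_forall fun x => ?_)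
    have := heq (x + v)
    have e : ∀ z, uv (x + z) = u (x + v + z) := fun z => by simp only [huv]; congr 1; abel
    have e' : ∀ z, uv (x - z) = u (x + v - z) := fun z => by simp only [huv]; congr 1; abel
    simp only [← this, e, e']; ring
  have hst' := stab_ext hd hs0 hs1 hgu hst hηL
  -- combine
  have hcs : ∀ g : Eu d → ℝ, Continuous g → Integrable (fun x => φ x * (φ x * W x) * g x) := by
    intro g hg
    exact (hψL.continuous.mul hg).integrable_of_hasCompactSupport hψL.hasCompactSupport.mul_right
  have j1 := hcs _ hfuv
  have j2 := hcs _ hfu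
  have j3 := hcs (fun x => f' (u x) * W x) (hgu.mul hWc)
  have j12 : Integrable (fun x => φ x * (φ x * W x) * f (u (x + v)) - φ x * (φ x * W x) * f (u x)) := j1.sub j2
  have j4 : Integrable (fun x => φ x * |W x|) := hηL.continuous.integrable_of_hasCompactSupport hηL.hasCompactSupport
  have es : ∫ x, f' (u x) * (φ x * |W x|) ^ 2 = ∫ x, φ x * (φ x * W x) * (f' (u x) * W x) := by
    refine integral_congr_ae (Filter.Eventually.of_forall fun x => ?_)
    simp only [mul_pow, sq_abs]; ring
  rw [es] at hst'
  have herr : (∫ x, φ x * (φ x * W x) * f (u (x + v))) - (∫ x, φ x * (φ x * W x) * f (u x)) - (∫ x, φ x * (φ x * W x) * (f' (u x) * W x))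
      ≤ Cα * b ^ (1 + α) * ∫ x, φ x * |W x| := by
    rw [← integral_sub j1 j2, ← integral_sub j12 j3, ← integral_const_mul]
    refine integral_mono (j12.sub j3) (j4.const_mul _) fun x => ?_
    have hm := mvt_holder hα hder hC hH (hmem x) (hmem (x + v))
    rw [← hW] at hm
    have hxb := hWb x
    have hE : |f (u (x + v)) - f (u x) - f' (u x) * W x| ≤ Cα * b ^ α * b := by
      refine hm.trans ?_
      gcongr
    have : φ x * (φ x * W x) * f (u (x + v)) - φ x * (φ x * W x) * f (u x) - φ x * (φ x * W x) * (f' (u x) * W x)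
        = φ x * (φ x * W x) * (f (u (x + v)) - f (u x) - f' (u x) * W x) := by ring
    simp only
    rw [this]
    refine (le_abs_self _).trans ?_
    rw [abs_mul, abs_mul, abs_mul, abs_of_nonneg (hφ0 x)]
    calc φ x * (φ x * |W x|) * |f (u (x + v)) - f (u x) - f' (u x) * W x| ≤ 1 * (φ x * |W x|) * (Cα * b ^ α * b) := by
          have := hφ0 x
          gcongr
          exact hφ1 x
      _ = _ := by rw [Real.rpow_add hb0, Real.rpow_one]; ring
  rw [hw2]
  linarith [cu, cv, hst', herr]

lemma cut_mul_integrable {d : ℕ} (x₀ : Eu d) {R : ℝ} (hR : 1 ≤ R) {w : Eu d → ℝ} (hw : Continuous w) :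
    Integrable (fun x => cut x₀ R x * w x) :=
  ((cut_cont x₀ hR).mul hw).integrable_of_hasCompactSupport (cut_LC x₀ hR).hasCompactSupport.mul_right

lemma lowE {d : ℕ} {p : ℝ} (hp : 0 < p) {W : Eu d → ℝ} (hW : Continuous W) (x₀ : Eu d) {R : ℝ} (hR : 1 ≤ R)
    (i4 : Integrable (fun q : Eu d × Eu d => cut x₀ R q.1 * cut x₀ R q.2 * (|W q.1 * W q.2| - W q.1 * W q.2) / ‖q.1 - q.2‖ ^ p) (volume.prod volume)) :
    4 * (4 * R) ^ (-p) * ((∫ x, cut x₀ R x * max (W x) 0) * ∫ x, cut x₀ R x * max (-W x) 0) ≤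
      ∫ q : Eu d × Eu d, cut x₀ R q.1 * cut x₀ R q.2 * (|W q.1 * W q.2| - W q.1 * W q.2) / ‖q.1 - q.2‖ ^ p ∂(volume.prod volume) := by
  have hR0 : 0 < R := by linarith
  set φ := cut x₀ R with hφ
  have hφ0 : ∀ x, 0 ≤ φ x := cut_nonneg _ _
  have ip : Integrable (fun x => φ x * max (W x) 0) := cut_mul_integrable x₀ hR (by fun_prop)
  have im : Integrable (fun x => φ x * max (-W x) 0) := cut_mul_integrable x₀ hR (by fun_prop)
  have k1 := (ip.mul_prod im).const_mul (2 * (4 * R) ^ (-p))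
  have k2 := (im.mul_prod ip).const_mul (2 * (4 * R) ^ (-p))
  have e : 4 * (4 * R) ^ (-p) * ((∫ x, φ x * max (W x) 0) * ∫ x, φ x * max (-W x) 0) =
     ∫ q : Eu d × Eu d, 2 * (4 * R) ^ (-p) * ((φ q.1 * max (W q.1) 0) * (φ q.2 * max (-W q.2) 0))
      + 2 * (4 * R) ^ (-p) * ((φ q.1 * max (-W q.1) 0) * (φ q.2 * max (W q.2) 0)) ∂(volume.prod volume) := by
    rw [integral_add k1 k2, integral_const_mul, integral_const_mul,
      integral_prod_mul (fun x => φ x * max (W x) 0) (fun x => φ x * max (-W x) 0),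
      integral_prod_mul (fun x => φ x * max (-W x) 0) (fun x => φ x * max (W x) 0)]
    ring
  rw [e]
  refine integral_mono (k1.add k2) i4 fun q => ?_
  obtain ⟨x, y⟩ := q
  simp only
  have hab : ∀ a b : ℝ, |a * b| - a * b = 2 * (max a 0 * max (-b) 0 + max (-a) 0 * max b 0) := by
    intro a b
    rw [abs_mul]
    rcases le_total a 0 with ha | ha <;> rcases le_total b 0 with hb | hb
    · rw [abs_of_nonpos ha, abs_of_nonpos hb, max_eq_right ha, max_eq_right hb]; ring
    · rw [abs_of_nonpos ha, abs_of_nonneg hb, max_eq_right ha, max_eq_left hb, max_eq_left (by linarith : 0 ≤ -a)]; ring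
    · rw [abs_of_nonneg ha, abs_of_nonpos hb, max_eq_left ha, max_eq_right hb, max_eq_left (by linarith : 0 ≤ -b)]; ring
    · rw [abs_of_nonneg ha, abs_of_nonneg hb, max_eq_right (by linarith : -a ≤ 0), max_eq_right (by linarith : -b ≤ 0)]; ring
  have e2 : 2 * (4 * R) ^ (-p) * ((φ x * max (W x) 0) * (φ y * max (-W y) 0))
      + 2 * (4 * R) ^ (-p) * ((φ x * max (-W x) 0) * (φ y * max (W y) 0)) =
      φ x * φ y * (|W x * W y| - W x * W y) * (4 * R) ^ (-p) := by rw [hab]; ring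
  rw [e2, div_eq_mul_inv]
  have hnn : 0 ≤ |W x * W y| - W x * W y := by linarith [le_abs_self (W x * W y)]
  rcases (norm_nonneg (x - y)).eq_or_lt with h0 | h0
  · have : x = y := by rwa [eq_comm, norm_eq_zero, sub_eq_zero] at h0
    subst this
    rw [abs_of_nonneg (mul_self_nonneg _)]; simp
  · by_cases hx : 2 * R ≤ ‖x - x₀‖
    · rw [hφ, cut_zero hR0 hx]; simp
    by_cases hy : 2 * R ≤ ‖y - x₀‖
    · rw [hφ, cut_zero hR0 hy]; simp
    push Not at hx hy
    have hxy : ‖x - y‖ ≤ 4 * R := by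
      have := norm_sub_le (x - x₀) (y - x₀)
      rw [sub_sub_sub_cancel_right] at this; linarith
    have := hφ0 x
    have := hφ0 y
    rw [← Real.rpow_neg h0.le]
    have := Real.rpow_le_rpow_of_nonpos h0 hxy (by linarith : -p ≤ 0)
    gcongr

lemma upQ {d : ℕ} {p : ℝ} {W : Eu d → ℝ} (hW : Continuous W) (x₀ : Eu d) {R : ℝ} (hR : 1 ≤ R)
    (i3 : Integrable (fun q : Eu d × Eu d => W q.1 * W q.2 * (cut x₀ R q.1 - cut x₀ R q.2) ^ 2 / ‖q.1 - q.2‖ ^ p) (volume.prod volume))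
    {Λ : ℝ} (hΛ : ∀ x, |∫ y, W y * ((cut x₀ R x - cut x₀ R y) ^ 2 * (2 - cut x₀ (2 * R) y) * (‖x - y‖ ^ p)⁻¹)| ≤ Λ) :
    ∫ q : Eu d × Eu d, W q.1 * W q.2 * (cut x₀ R q.1 - cut x₀ R q.2) ^ 2 / ‖q.1 - q.2‖ ^ p ∂(volume.prod volume) ≤
      Λ * ∫ x, cut x₀ (2 * R) x * |W x| := by
  have hR0 : 0 < R := by linarith
  set φ := cut x₀ R with hφ
  set χ := cut x₀ (2 * R) with hχ
  have hχ0 : ∀ x, 0 ≤ χ x := cut_nonneg _ _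
  have hχ1 : ∀ x, χ x ≤ 1 := cut_le_one _ _
  have hχc : Continuous χ := cut_cont x₀ (by linarith)
  have hχb : ∀ x, ‖χ x‖ ≤ 1 := fun x => by rw [Real.norm_of_nonneg (hχ0 x)]; exact hχ1 x
  set S : Eu d × Eu d → ℝ := fun q => W q.1 * W q.2 * (φ q.1 - φ q.2) ^ 2 / ‖q.1 - q.2‖ ^ p with hS
  have hsym : ∀ q, S q.swap = S q := by
    intro q
    simp only [hS, Prod.fst_swap, Prod.snd_swap]
    rw [norm_sub_rev]; ring
  have hz : ∀ x, χ x ≠ 1 → φ x = 0 := by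
    intro x hx
    apply cut_zero hR0
    by_contra h
    exact hx (cut_one (by linarith) (by linarith))
  have hid : ∀ q, S q = χ q.1 * S q + χ q.2 * S q - χ q.1 * χ q.2 * S q := by
    intro q
    by_cases h1 : χ q.1 = 1
    · rw [h1]; ring
    by_cases h2 : χ q.2 = 1
    · rw [h2]; ring
    simp only [hS]
    rw [hz _ h1, hz _ h2]; simp
  have m1 : AEStronglyMeasurable (fun q : Eu d × Eu d => χ q.1) (volume.prod volume) :=
    (by fun_prop : Continuous _).aestronglyMeasurable
  have m2 : AEStronglyMeasurable (fun q : Eu d × Eu d => χ q.2) (volume.prod volume) :=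
    (by fun_prop : Continuous _).aestronglyMeasurable
  have j1 : Integrable (fun q => χ q.1 * S q) (volume.prod volume) := i3.bdd_mul m1 (Filter.Eventually.of_forall fun q => hχb _)
  have j2 : Integrable (fun q => χ q.2 * S q) (volume.prod volume) := i3.bdd_mul m2 (Filter.Eventually.of_forall fun q => hχb _)
  have j3 : Integrable (fun q => χ q.1 * χ q.2 * S q) (volume.prod volume) := by
    have := j2.bdd_mul m1 (Filter.Eventually.of_forall fun q => hχb _)
    simpa only [mul_assoc] using this
  have j12 : Integrable (fun q => χ q.1 * S q + χ q.2 * S q) (volume.prod volume) := j1.add j2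
  have eswap : ∫ q, χ q.2 * S q ∂(volume.prod volume) = ∫ q, χ q.1 * S q ∂(volume.prod volume) := by
    rw [← integral_prod_swap]
    simp only [hsym, Prod.snd_swap]
  have j5 : Integrable (fun q => χ q.1 * (2 - χ q.2) * S q) (volume.prod volume) := by
    refine ((j1.const_mul 2).sub j3).congr (Filter.Eventually.of_forall fun q => ?_)
    simp only [Pi.sub_apply]; ring
  have e1 : ∫ q, S q ∂(volume.prod volume) = ∫ q, χ q.1 * (2 - χ q.2) * S q ∂(volume.prod volume) := by
    calc ∫ q, S q ∂(volume.prod volume) = ∫ q, χ q.1 * S q + χ q.2 * S q - χ q.1 * χ q.2 * S q ∂(volume.prod volume) := by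
          refine integral_congr_ae (Filter.Eventually.of_forall fun q => hid q)
      _ = 2 * (∫ q, χ q.1 * S q ∂(volume.prod volume)) - ∫ q, χ q.1 * χ q.2 * S q ∂(volume.prod volume) := by
          rw [integral_sub j12 j3, integral_add j1 j2, eswap]; ring
      _ = _ := by
          rw [← integral_const_mul, ← integral_sub (j1.const_mul 2) j3]
          refine integral_congr_ae (Filter.Eventually.of_forall fun q => ?_)
          simp only; ring
  have e2 : ∫ q, χ q.1 * (2 - χ q.2) * S q ∂(volume.prod volume) =
      ∫ x, χ x * W x * ∫ y, W y * ((φ x - φ y) ^ 2 * (2 - χ y) * (‖x - y‖ ^ p)⁻¹) := by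
    rw [integral_prod _ j5]
    refine integral_congr_ae (Filter.Eventually.of_forall fun x => ?_)
    simp only
    rw [← integral_const_mul]
    refine integral_congr_ae (Filter.Eventually.of_forall fun y => ?_)
    simp only [hS]; ring
  change ∫ q, S q ∂(volume.prod volume) ≤ _
  rw [e1, e2]
  have iP : Integrable (fun x => χ x * |W x|) := cut_mul_integrable x₀ (by linarith) hW.abs
  rw [← integral_const_mul]
  refine (le_abs_self _).trans ?_
  rw [← Real.norm_eq_abs]
  refine norm_integral_le_of_norm_le (iP.const_mul Λ) (Filter.Eventually.of_forall fun x => ?_)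
  rw [norm_mul, norm_mul, Real.norm_of_nonneg (hχ0 x)]
  have := hΛ x
  have := hχ0 x
  calc χ x * ‖W x‖ * _ ≤ χ x * ‖W x‖ * Λ := by gcongr; assumption
    _ = _ := by rw [Real.norm_eq_abs]; ring

lemma difG {d : ℕ} {u : Eu d → ℝ} (hu : Continuous u) (hb : ∀ x, |u x| ≤ 1) {v : Eu d} {h : ℝ} (hh : 0 < h) (hh1 : h ≤ 1) (hv : ‖v‖ = h)
    (x₀ : Eu d) {R : ℝ} (hR : 1 ≤ R) :
    |∫ x, cut x₀ R x * (u (x + v) - u x)| ≤ 3 ^ d * volume.real (ball (0 : Eu d) 1) * (h * R ^ ((d:ℝ) - 1)) := by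
  have hR0 : 0 < R := by linarith
  set φ := cut x₀ R with hφ
  have hφc : Continuous φ := cut_cont x₀ hR
  have j1 : Integrable (fun x => φ x * u x) := cut_mul_integrable x₀ hR hu
  have j2 : Integrable (fun x => φ x * u (x + v)) := cut_mul_integrable x₀ hR (by fun_prop)
  have j3 : Integrable (fun x => φ (x - v) * u x) := by
    have := j2.comp_sub_right v
    simpa using this
  have e : ∫ x, φ x * (u (x + v) - u x) = ∫ x, (φ (x - v) - φ x) * u x := by
    have e1 : ∫ x, φ x * u (x + v) = ∫ x, φ (x - v) * u x := by
      rw [← integral_add_right_eq_self (fun x => φ (x - v) * u x) v]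
      simp only [add_sub_cancel_right]
    simp only [mul_sub, sub_mul]
    rw [integral_sub j2 j1, integral_sub j3 j1, e1]
  rw [e]
  have hbd : ∀ x, ‖(φ (x - v) - φ x) * u x‖ ≤ (closedBall x₀ (3 * R)).indicator (fun _ => h / R) x := by
    intro x
    by_cases hx : x ∈ closedBall x₀ (3 * R)
    · rw [indicator_of_mem hx, norm_mul]
      have := cut_lip x₀ hR0 (x - v) x
      rw [sub_sub_cancel_left, norm_neg, hv] at this
      calc _ ≤ (h / R) * 1 := by gcongr; exacts [this, hb x]
        _ = _ := mul_one _
    · rw [indicator_of_notMem hx]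
      rw [mem_closedBall, dist_eq_norm, not_le] at hx
      have h1 : φ x = 0 := cut_zero hR0 (by linarith)
      have h2 : φ (x - v) = 0 := cut_zero hR0 (by
        have := norm_sub_norm_le (x - x₀) v
        rw [show x - x₀ - v = x - v - x₀ by abel, hv] at this
        linarith)
      rw [h1, h2]; simp
  have hi : Integrable ((closedBall x₀ (3 * R)).indicator (fun _ => h / R)) := by
    rw [integrable_indicator_iff measurableSet_closedBall]
    exact integrableOn_const (by exact measure_closedBall_lt_top.ne)
  have := norm_integral_le_of_norm_le hi (Filter.Eventually.of_forall hbd)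
  rw [Real.norm_eq_abs, integral_indicator measurableSet_closedBall, setIntegral_const, smul_eq_mul] at this
  refine this.trans (le_of_eq ?_)
  have hvol : volume.real (closedBall x₀ (3 * R)) = (3 * R) ^ d * volume.real (ball (0 : Eu d) 1) := by
    rw [Measure.real, Measure.addHaar_closedBall _ _ (by positivity), ENNReal.toReal_mul, ENNReal.toReal_ofReal (by positivity)]
    simp [Measure.real]
  rw [hvol, Real.rpow_sub_one hR0.ne', Real.rpow_natCast, mul_pow]
  field_simp

lemma cut_mono {d : ℕ} (x₀ : Eu d) {R : ℝ} (hR : 1 ≤ R) (x : Eu d) : cut x₀ R x ≤ cut x₀ (2 * R) x := by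
  unfold cut
  gcongr
  linarith

set_option maxHeartbeats 2000000 in
lemma core {d : ℕ} (hd : 1 ≤ d) {s : ℝ} (hs0 : 1/2 ≤ s) (hs1 : s < 1) {c : ℝ} (hc : 0 < c) {α Cα CH β : ℝ}
    (hCα : 0 ≤ Cα) (hCH : 0 < CH) (hβ : 0 < β) (hβ0 : 2 * s - 1 < β) :
    ∃ C : ℝ, 0 ≤ C ∧ ∀ (f f' : ℝ → ℝ) (u : Eu d → ℝ), Sol d s c f f' α Cα u → (∀ x y, |u x - u y| ≤ CH * ‖x - y‖ ^ β) →
      ∀ (v : Eu d) (h : ℝ), 0 < h → h ≤ 1 → ‖v‖ = h → ∀ (x₀ : Eu d) (R : ℝ), 1 ≤ R →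
      (∫ x, cut x₀ R x * |u (x + v) - u x|) ^ 2 ≤ C * (h * R ^ ((d:ℝ) - 1)) ^ 2 +
        C * (R ^ ((d:ℝ) + 2 * s) * (h * (R ^ 2)⁻¹ * (1 + Real.log R) + h ^ (β * (1 + α)))) * ∫ x, cut x₀ (2 * R) x * |u (x + v) - u x| := by
  obtain ⟨CF, hCF, hF⟩ := inner_F hd hs0 hs1 hβ hβ0 hCH.le
  set p : ℝ := (d:ℝ) + 2 * s with hp
  have hp0 : 0 < p := by rw [hp]; positivity
  set A1 : ℝ := 3 ^ d * volume.real (ball (0 : Eu d) 1) with hA1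
  set A2 : ℝ := 4 ^ p / (2 * c) * (c * CF + Cα * CH ^ (1 + α)) with hA2
  have hA20 : 0 ≤ A2 := by positivity
  refine ⟨A1 ^ 2 + A2, by positivity, ?_⟩
  intro f f' u H huH v h hh hh1 hv x₀ R hR
  have hR0 : 0 < R := by linarith
  have hlog : 0 ≤ Real.log R := Real.log_nonneg hR
  have huc := H.hu.continuous
  set W : Eu d → ℝ := fun x => u (x + v) - u x with hW
  have hWc : Continuous W := by rw [hW]; fun_prop
  have hWb : ∀ x, |W x| ≤ CH * h ^ β := fun x => by
    have := huH (x + v) x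
    rwa [add_sub_cancel_left, hv] at this
  obtain ⟨i3, i4, hD⟩ := mainD H (W := W) (v := v) (fun x => rfl) (b := CH * h ^ β) (by positivity) hWb x₀ hR
  have hE := lowE hp0 hWc x₀ hR i4
  have hQ := upQ hWc x₀ hR i3 (fun x => hF u huc H.hb huH v h hh hh1 hv x₀ R hR x)
  have hG := difG huc H.hb hh hh1 hv x₀ hR
  have hpow : (CH * h ^ β) ^ (1 + α) = CH ^ (1 + α) * h ^ (β * (1 + α)) := by
    rw [Real.mul_rpow hCH.le (by positivity), ← Real.rpow_mul hh.le]
  rw [hpow] at hD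
  set φ := cut x₀ R with hφ
  have ip : Integrable (fun x => φ x * max (W x) 0) := cut_mul_integrable x₀ hR (by fun_prop)
  have im : Integrable (fun x => φ x * max (-W x) 0) := cut_mul_integrable x₀ hR (by fun_prop)
  have ia : Integrable (fun x => φ x * |W x|) := cut_mul_integrable x₀ hR (by fun_prop)
  have ia2 : Integrable (fun x => cut x₀ (2 * R) x * |W x|) := cut_mul_integrable x₀ (by linarith) (by fun_prop)
  have hPP : ∫ x, φ x * |W x| ≤ ∫ x, cut x₀ (2 * R) x * |W x| := by
    refine integral_mono ia ia2 fun x => ?_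
    have := cut_mono x₀ hR x
    simp only
    gcongr
  have hsum : ∫ x, φ x * |W x| = (∫ x, φ x * max (W x) 0) + ∫ x, φ x * max (-W x) 0 := by
    rw [← integral_add ip im]
    congr 1; ext x
    rcases le_total (W x) 0 with ha | ha
    · rw [abs_of_nonpos ha, max_eq_right ha, max_eq_left (by linarith)]; ring
    · rw [abs_of_nonneg ha, max_eq_left ha, max_eq_right (by linarith)]; ring
  have hdif : ∫ x, φ x * (u (x + v) - u x) = (∫ x, φ x * max (W x) 0) - ∫ x, φ x * max (-W x) 0 := by
    rw [← integral_sub ip im]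
    congr 1; ext x
    change φ x * W x = _
    rcases le_total (W x) 0 with ha | ha
    · rw [max_eq_right ha, max_eq_left (by linarith)]; ring
    · rw [max_eq_left ha, max_eq_right (by linarith)]; ring
  rw [hdif] at hG
  change (∫ x, φ x * |W x|) ^ 2 ≤ _ + _ * ∫ x, cut x₀ (2 * R) x * |W x|
  have hP20 : 0 ≤ ∫ x, cut x₀ (2 * R) x * |W x| := integral_nonneg fun x => mul_nonneg (cut_nonneg _ _ _) (abs_nonneg _)
  set P2 := ∫ x, cut x₀ (2 * R) x * |W x|
  set P := ∫ x, φ x * |W x|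
  set Pp := ∫ x, φ x * max (W x) 0
  set Pm := ∫ x, φ x * max (-W x) 0
  set T := ∫ q : Eu d × Eu d, φ q.1 * φ q.2 * (|W q.1 * W q.2| - W q.1 * W q.2) / ‖q.1 - q.2‖ ^ p ∂(volume.prod volume)
  set Q := ∫ q : Eu d × Eu d, W q.1 * W q.2 * (φ q.1 - φ q.2) ^ 2 / ‖q.1 - q.2‖ ^ p ∂(volume.prod volume)
  set a : ℝ := h * (R ^ 2)⁻¹ * (1 + Real.log R)
  set b : ℝ := h ^ (β * (1 + α))
  have ha0 : 0 ≤ a := by positivity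
  have hb0 : 0 ≤ b := by positivity
  have h1 : 2 * c * (4 * (4 * R) ^ (-p) * (Pp * Pm)) ≤ (c * (CF * a) + Cα * (CH ^ (1 + α) * b)) * P2 := by
    calc 2 * c * (4 * (4 * R) ^ (-p) * (Pp * Pm)) ≤ 2 * c * T := by gcongr
      _ ≤ c * Q + Cα * (CH ^ (1 + α) * b) * P := hD
      _ ≤ c * (CF * a * P2) + Cα * (CH ^ (1 + α) * b) * P2 := by gcongr
      _ = _ := by ring
  have h2 : c * (CF * a) + Cα * (CH ^ (1 + α) * b) ≤ (c * CF + Cα * CH ^ (1 + α)) * (a + b) := by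
    have t1 : 0 ≤ c * CF * b := by positivity
    have t2 : 0 ≤ Cα * CH ^ (1 + α) * a := by positivity
    nlinarith
  have h3 : 4 * (Pp * Pm) ≤ A2 * (R ^ p * (a + b)) * P2 := by
    have hpos : 0 < (4 * R) ^ p := by positivity
    have e : 2 * c * (4 * (4 * R) ^ (-p) * (Pp * Pm)) = (2 * c * ((4 * R) ^ p)⁻¹) * (4 * (Pp * Pm)) := by
      rw [Real.rpow_neg (by positivity)]; ring
    rw [e] at h1
    have h4 : 4 * (Pp * Pm) ≤ ((c * CF + Cα * CH ^ (1 + α)) * (a + b)) * P2 / (2 * c * ((4 * R) ^ p)⁻¹) := by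
      rw [le_div_iff₀ (by positivity), mul_comm]
      exact h1.trans (by gcongr)
    refine h4.trans (le_of_eq ?_)
    rw [hA2, Real.mul_rpow (by norm_num) hR0.le]
    field_simp
  have h5 : (Pp - Pm) ^ 2 ≤ A1 ^ 2 * (h * R ^ ((d:ℝ) - 1)) ^ 2 := by
    rw [← mul_pow, ← sq_abs]; gcongr
  have t1 : 0 ≤ A2 * (h * R ^ ((d:ℝ) - 1)) ^ 2 := by positivity
  have t2 : 0 ≤ A1 ^ 2 * (R ^ p * (a + b)) * P2 := by positivity
  rw [hsum]
  nlinarith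

lemma bootstrap {q N : ℝ → ℝ} {C D B : ℝ} (hC : 0 ≤ C) (hD : 0 ≤ D) (hN : ∀ R, 1 ≤ R → 0 < N R)
    (hq0 : ∀ R, 1 ≤ R → 0 ≤ q R) (hB : ∀ R, 1 ≤ R → q R ≤ B * N R) (hN2 : ∀ R, 1 ≤ R → N (2 * R) ≤ D * N R)
    (h : ∀ R, 1 ≤ R → q R ^ 2 ≤ C * (N R) ^ 2 + C * N R * q (2 * R)) :
    ∀ R, 1 ≤ R → q R ≤ (1 + C + C * D) * N R := by
  set A : Set ℝ := (fun R => q R / N R) '' Ici 1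
  have hbdd : BddAbove A := ⟨B, by
    rintro _ ⟨R, hR, rfl⟩
    simp only
    rw [div_le_iff₀ (hN R hR)]; exact hB R hR⟩
  set S := sSup A
  have hS : ∀ R, 1 ≤ R → q R ≤ S * N R := fun R hR => by
    rw [← div_le_iff₀ (hN R hR)]
    exact le_csSup hbdd ⟨R, hR, rfl⟩
  have hS0 : 0 ≤ S := by
    have h1 := hS 1 le_rfl
    have h2 := hq0 1 le_rfl
    have h3 := hN 1 le_rfl
    by_contra hneg
    push Not at hneg
    nlinarith
  have hsq : ∀ R, 1 ≤ R → (q R / N R) ^ 2 ≤ C + C * D * S := fun R hR => by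
    have hNR := hN R hR
    rw [div_pow, div_le_iff₀ (by positivity)]
    have h1 := hS (2 * R) (by linarith)
    have h2 := hN2 R hR
    calc q R ^ 2 ≤ C * (N R) ^ 2 + C * N R * q (2 * R) := h R hR
      _ ≤ C * (N R) ^ 2 + C * N R * (S * (D * N R)) := by
          gcongr
          exact h1.trans (by gcongr)
      _ = _ := by ring
  have hle : S ≤ Real.sqrt (C + C * D * S) := by
    apply csSup_le (Set.Nonempty.image _ nonempty_Ici)
    rintro _ ⟨R, hR, rfl⟩
    exact Real.le_sqrt_of_sq_le (hsq R hR)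
  have hS2 : S ^ 2 ≤ C + C * D * S := by
    have h0 : 0 ≤ C + C * D * S := by positivity
    calc S ^ 2 ≤ Real.sqrt (C + C * D * S) ^ 2 := by gcongr
      _ = _ := Real.sq_sqrt h0
  have hCD : 0 ≤ C * D := by positivity
  have hfin : S ≤ 1 + C + C * D := by
    by_contra hneg
    push Not at hneg
    nlinarith
  intro R hR
  exact (hS R hR).trans (by have := hN R hR; gcongr)

lemma hbound {d : ℕ} (hd : 1 ≤ d) {s : ℝ} (hs0 : 1/2 ≤ s) (hs1 : s < 1) {c : ℝ} (hc : 0 < c) {α Cα CH β : ℝ}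
    (hCα : 0 ≤ Cα) (hCH : 0 < CH) (hβ : 0 < β) (hβ0 : 2 * s - 1 < β) :
    ∃ C : ℝ, 0 ≤ C ∧ ∀ (f f' : ℝ → ℝ) (u : Eu d → ℝ), Sol d s c f f' α Cα u → (∀ x y, |u x - u y| ≤ CH * ‖x - y‖ ^ β) →
      ∀ (v : Eu d) (h : ℝ), 0 < h → h ≤ 1 → ‖v‖ = h → ∀ (x₀ : Eu d) (R : ℝ), 1 ≤ R →
      (∫ x, cut x₀ R x * |u (x + v) - u x|) / h ≤ C *
        (R ^ ((d:ℝ) + 2 * s) * ((R ^ 2)⁻¹ * (1 + Real.log R) + h ^ (β * (1 + α) - 1))) := by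
  obtain ⟨C, hC, hcore⟩ := core hd hs0 hs1 hc (α := α) hCα hCH hβ hβ0
  set p : ℝ := (d:ℝ) + 2 * s with hp
  set γ : ℝ := β * (1 + α) - 1 with hγ
  refine ⟨1 + C + C * 2 ^ p, by positivity, ?_⟩
  intro f f' u H huH v h hh hh1 hv x₀
  have huc := H.hu.continuous
  have hγ0 : 0 < h ^ γ := by positivity
  refine bootstrap (q := fun R => (∫ x, cut x₀ R x * |u (x + v) - u x|) / h)
    (N := fun R => R ^ p * ((R ^ 2)⁻¹ * (1 + Real.log R) + h ^ γ)) (C := C) (D := 2 ^ p)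
    (B := 2 * (2 ^ d * volume.real (ball (0 : Eu d) 1)) / h * (h ^ γ)⁻¹) hC (by positivity) ?_ ?_ ?_ ?_ ?_
  · intro R hR
    have hlog : 0 ≤ Real.log R := Real.log_nonneg hR
    positivity
  · intro R hR
    exact div_nonneg (integral_nonneg fun x => mul_nonneg (cut_nonneg _ _ _) (abs_nonneg _)) hh.le
  · intro R hR
    have hR0 : 0 < R := by linarith
    have hlog : 0 ≤ Real.log R := Real.log_nonneg hR
    have hbd : ∀ x, ‖cut x₀ R x * |u (x + v) - u x|‖ ≤ (closedBall x₀ (2 * R)).indicator (fun _ => (2:ℝ)) x := by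
      intro x
      by_cases hx : x ∈ closedBall x₀ (2 * R)
      · rw [indicator_of_mem hx, norm_mul, Real.norm_of_nonneg (cut_nonneg _ _ _), norm_abs_eq_norm]
        have h2 : ‖u (x + v) - u x‖ ≤ 2 := by
          have := abs_sub (u (x + v)) (u x)
          rw [Real.norm_eq_abs]; linarith [H.hb x, H.hb (x + v)]
        calc _ ≤ 1 * (2:ℝ) := by gcongr; exact cut_le_one _ _ _
          _ = _ := one_mul _
      · rw [indicator_of_notMem hx]
        rw [mem_closedBall, dist_eq_norm, not_le] at hx
        rw [cut_zero hR0 hx.le]; simp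
    have hi : Integrable ((closedBall x₀ (2 * R)).indicator (fun _ => (2:ℝ))) := by
      rw [integrable_indicator_iff measurableSet_closedBall]
      exact integrableOn_const (by exact measure_closedBall_lt_top.ne)
    have := norm_integral_le_of_norm_le hi (Filter.Eventually.of_forall hbd)
    rw [Real.norm_eq_abs, integral_indicator measurableSet_closedBall, setIntegral_const, smul_eq_mul] at this
    have hvol : volume.real (closedBall x₀ (2 * R)) = (2 * R) ^ d * volume.real (ball (0 : Eu d) 1) := by
      rw [Measure.real, Measure.addHaar_closedBall _ _ (by positivity), ENNReal.toReal_mul, ENNReal.toReal_ofReal (by positivity)]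
      simp [Measure.real]
    rw [hvol] at this
    have hRd : R ^ d ≤ R ^ p := by
      rw [← Real.rpow_natCast]
      exact Real.rpow_le_rpow_of_exponent_le hR (by rw [hp]; linarith)
    have hN : R ^ d * h ^ γ ≤ R ^ p * ((R ^ 2)⁻¹ * (1 + Real.log R) + h ^ γ) := by
      have : 0 ≤ (R ^ 2)⁻¹ * (1 + Real.log R) := by positivity
      gcongr; linarith
    calc (∫ x, cut x₀ R x * |u (x + v) - u x|) / h ≤ ((2 * R) ^ d * volume.real (ball (0 : Eu d) 1) * 2) / h := by
          gcongr
          exact (le_abs_self _).trans this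
      _ = 2 * (2 ^ d * volume.real (ball (0 : Eu d) 1)) / h * (h ^ γ)⁻¹ * (R ^ d * h ^ γ) := by
          rw [mul_pow]; field_simp
      _ ≤ _ := by gcongr
  · intro R hR
    have hR0 : 0 < R := by linarith
    have hlog : 0 ≤ Real.log R := Real.log_nonneg hR
    rw [Real.mul_rpow (by norm_num) hR0.le, Real.log_mul (by norm_num) hR0.ne', mul_assoc]
    have hl2 : Real.log 2 ≤ 1 := by linarith [Real.log_two_lt_d9]
    have : ((2 * R) ^ 2)⁻¹ * (1 + (Real.log 2 + Real.log R)) ≤ (R ^ 2)⁻¹ * (1 + Real.log R) := by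
      rw [mul_pow, mul_inv, mul_comm _ (R ^ 2)⁻¹, mul_assoc]
      gcongr
      linarith
    gcongr
  · intro R hR
    have hR0 : 0 < R := by linarith
    have hlog : 0 ≤ Real.log R := Real.log_nonneg hR
    have hk := hcore f f' u H huH v h hh hh1 hv x₀ R hR
    have e1 : h ^ (β * (1 + α)) = h * h ^ γ := by
      rw [hγ, Real.rpow_sub_one hh.ne']; field_simp
    have hN : R ^ ((d:ℝ) - 1) ≤ R ^ p * ((R ^ 2)⁻¹ * (1 + Real.log R) + h ^ γ) := by
      have h1 : R ^ ((d:ℝ) - 1) ≤ R ^ (p - 2) := Real.rpow_le_rpow_of_exponent_le hR (by rw [hp]; linarith)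
      rw [Real.rpow_sub hR0 p 2, Real.rpow_two] at h1
      refine h1.trans ?_
      rw [div_eq_mul_inv]
      gcongr
      have : (R ^ 2)⁻¹ * 1 ≤ (R ^ 2)⁻¹ * (1 + Real.log R) := by gcongr; linarith
      linarith
    set N := R ^ p * ((R ^ 2)⁻¹ * (1 + Real.log R) + h ^ γ)
    rw [e1] at hk
    rw [div_pow, div_le_iff₀ (by positivity)]
    refine hk.trans ?_
    have e2 : R ^ p * (h * (R ^ 2)⁻¹ * (1 + Real.log R) + h * h ^ γ) = h * N := by ring
    rw [e2]
    calc _ ≤ C * (h * N) ^ 2 + C * (h * N) * (∫ x, cut x₀ (2 * R) x * |u (x + v) - u x|) := by gcongr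
      _ = _ := by field_simp

lemma norm_le_sum {d : ℕ} (T : Eu d →L[ℝ] ℝ) : ‖T‖ ≤ ∑ i, |T (EuclideanSpace.single i 1)| := by
  refine T.opNorm_le_bound (Finset.sum_nonneg fun i _ => abs_nonneg _) fun x => ?_
  have hx : x = ∑ i, x i • (EuclideanSpace.single i (1:ℝ) : Eu d) := by
    ext j
    simp [Pi.single_apply]
  conv_lhs => rw [hx, map_sum]
  refine (norm_sum_le _ _).trans ?_
  rw [Finset.sum_mul]
  refine Finset.sum_le_sum fun i _ => ?_
  rw [map_smul, norm_smul, mul_comm]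
  have := PiLp.norm_apply_le x i
  gcongr
  exact le_of_eq (Real.norm_eq_abs _)

lemma dirbound {d : ℕ} {u : Eu d → ℝ} (hu : ContDiff ℝ 2 u) (hb : ∀ x, |u x| ≤ 1) {e : Eu d} (he : ‖e‖ = 1) (x₀ : Eu d) {R : ℝ} (hR : 1 ≤ R)
    {A B γ : ℝ} (hγ : 0 < γ)
    (hh : ∀ h : ℝ, 0 < h → h ≤ 1 → (∫ x, cut x₀ R x * |u (x + h • e) - u x|) / h ≤ A + B * h ^ γ) :
    ∫ x in ball x₀ R, |fderiv ℝ u x e| ≤ A := by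
  have hR0 : 0 < R := by linarith
  have huc := hu.continuous
  set t : ℕ → ℝ := fun n => 1 / ((n:ℝ) + 1) with ht
  have ht0 : ∀ n, 0 < t n := fun n => by positivity
  have ht1 : ∀ n, t n ≤ 1 := fun n => by
    rw [ht]; simp only
    rw [div_le_one (by positivity)]; linarith [(Nat.cast_nonneg n : (0:ℝ) ≤ n)]
  have htl : Filter.Tendsto t Filter.atTop (nhds 0) := tendsto_one_div_add_atTop_nhds_zero_nat
  obtain ⟨K, hK0, hK⟩ := u_sub_le hu zero_le_one hb (‖x₀‖ + R)
  have hlim : Filter.Tendsto (fun n => ∫ x in ball x₀ R, |(t n)⁻¹ • (u (x + t n • e) - u x)|) Filter.atTop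
      (nhds (∫ x in ball x₀ R, |fderiv ℝ u x e|)) := by
    refine tendsto_integral_of_dominated_convergence (fun _ => K) ?_ ?_ ?_ ?_
    · intro n
      exact (by fun_prop : Continuous _).aestronglyMeasurable
    · exact integrableOn_const (by exact measure_ball_lt_top.ne)
    · intro n
      filter_upwards [ae_restrict_mem measurableSet_ball] with x hx
      have hxr : ‖x‖ ≤ ‖x₀‖ + R := by
        rw [mem_ball, dist_eq_norm] at hx
        have := norm_sub_norm_le x x₀
        linarith
      have := hK (x + t n • e) x (Or.inr hxr)
      rw [add_sub_cancel_left, norm_smul, he, mul_one, Real.norm_of_nonneg (ht0 n).le, min_eq_left (ht1 n)] at this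
      rw [norm_abs_eq_norm, norm_smul, norm_inv, Real.norm_of_nonneg (ht0 n).le, inv_mul_le_iff₀ (ht0 n), mul_comm]
      exact this
    · refine Filter.Eventually.of_forall fun x => ?_
      have hl := ((hu.differentiable (by norm_num) x).hasFDerivAt.hasLineDerivAt e).tendsto_slope_zero
      have h2 : Filter.Tendsto t Filter.atTop (nhdsWithin 0 {0}ᶜ) :=
        tendsto_nhdsWithin_iff.mpr ⟨htl, Filter.Eventually.of_forall fun n => (ht0 n).ne'⟩
      exact (hl.comp h2).abs
  have hlim2 : Filter.Tendsto (fun n => A + B * (t n) ^ γ) Filter.atTop (nhds A) := by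
    have h1 := (htl.rpow_const (Or.inr hγ.le : (0:ℝ) ≠ 0 ∨ 0 ≤ γ)).const_mul B |>.const_add A
    rw [Real.zero_rpow hγ.ne', mul_zero, add_zero] at h1
    exact h1
  refine le_of_tendsto_of_tendsto' hlim hlim2 fun n => ?_
  refine le_trans ?_ (hh (t n) (ht0 n) (ht1 n))
  have ia : Integrable (fun x => cut x₀ R x * |u (x + t n • e) - u x|) := cut_mul_integrable x₀ hR (by fun_prop)
  rw [div_eq_inv_mul, ← integral_const_mul]
  have e1 : ∫ x in ball x₀ R, |(t n)⁻¹ • (u (x + t n • e) - u x)| =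
      ∫ x in ball x₀ R, (t n)⁻¹ * (cut x₀ R x * |u (x + t n • e) - u x|) := by
    refine setIntegral_congr_fun measurableSet_ball fun x hx => ?_
    rw [mem_ball, dist_eq_norm] at hx
    rw [cut_one hR0 hx.le, one_mul, smul_eq_mul, abs_mul, abs_of_pos (inv_pos.mpr (ht0 n))]
  rw [e1]
  refine setIntegral_le_integral (ia.const_mul _) (Filter.Eventually.of_forall fun x => ?_)
  exact mul_nonneg (inv_pos.mpr (ht0 n)).le (mul_nonneg (cut_nonneg _ _ _) (abs_nonneg _))

lemma fracC_pos {d : ℕ} (hd : 1 ≤ d) {s : ℝ} (hs0 : 1/2 ≤ s) (hs1 : s < 1) : 0 < fracC d s := by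
  unfold fracC
  have h1 : 0 < Real.Gamma ((d:ℝ)/2 + s) := Real.Gamma_pos_of_pos (by positivity)
  have h2 : Real.Gamma (-s) ≠ 0 := by
    apply Real.Gamma_ne_zero
    intro m hm
    have hm' : s = m := by linarith
    rcases Nat.eq_zero_or_pos m with h | h
    · subst h; simp at hm'; linarith
    · have : (1:ℝ) ≤ m := by exact_mod_cast h
      linarith
  have := abs_pos.mpr h2
  have := Real.pi_pos
  positivity

/-- Let `d ≥ 1`, `1/2 ≤ s < 1`, `f` be `C^{1,α}` with `α > 0`, `u` a stable
solution of `(−Δ)^s u = f(u)` in `ℝ^d` with `|u| ≤ 1`, and `M₀ ≥ 2` an upper bound for the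
`L^∞` norm of `f` on `[−1,1]`. Then there is `C₂ = C₂(d,s,f)` such that for every `x₀` and
every `R ≥ 1`: `∫_{B_R(x₀)} |∇u| ≤ C₂ · R^{d+2s−2} · log(M₀R)`. -/
theorem stmt13 (d : ℕ) (hd : 1 ≤ d) (s α : ℝ) (hs0 : 1/2 ≤ s) (hs1 : s < 1) (hα : 0 < α)
    (f f' : ℝ → ℝ) (hf : IsC1Alpha f f' α)
    (M₀ : ℝ) (hM₀ : 2 ≤ M₀) (hfM : ∀ x ∈ Set.Icc (-1 : ℝ) 1, |f x| ≤ M₀) :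
    ∃ C₂ : ℝ, 0 < C₂ ∧
      ∀ u : EuclideanSpace ℝ (Fin d) → ℝ, IsStableSolution d s f f' u →
      ∀ x₀ : EuclideanSpace ℝ (Fin d), ∀ R : ℝ, 1 ≤ R →
        (∫ x in ball x₀ R, ‖fderiv ℝ u x‖) ≤
          C₂ * R ^ ((d : ℝ) + 2*s - 2) * Real.log (M₀ * R) := by
  obtain ⟨hder, Cα, hCα, hHol⟩ := hf
  have hc : 0 < fracC d s / 2 := by have := fracC_pos hd hs0 hs1; positivity
  set c := fracC d s / 2 with hcdef
  obtain ⟨β, hβ0, hβs, hβ1, hβα⟩ : ∃ β : ℝ, 0 < β ∧ 2 * s - 1 < β ∧ β < 1 ∧ 0 < β * (1 + α) - 1 := by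
    have h1 : 1 / (1 + α) < 1 := by rw [div_lt_one (by linarith)]; linarith
    have h0 : 0 < 1 / (1 + α) := by positivity
    obtain ⟨β, hb1, hb2⟩ := exists_between (max_lt h1 (by linarith : 2 * s - 1 < 1))
    have hb3 := (le_max_left (1 / (1 + α)) (2 * s - 1)).trans_lt hb1
    have hb4 := (le_max_right (1 / (1 + α)) (2 * s - 1)).trans_lt hb1
    refine ⟨β, by linarith, hb4, hb2, ?_⟩
    rw [div_lt_iff₀ (by linarith)] at hb3
    linarith
  obtain ⟨CH, hCH, hHu⟩ := holder_est hd hs0 hs1 hc (by linarith : (0:ℝ) ≤ M₀) hβ0 hβ1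
  obtain ⟨C, hC, hbd⟩ := hbound hd hs0 hs1 hc (α := α) hCα hCH hβ0 hβs
  have hl2 : 0 < Real.log 2 := Real.log_pos (by norm_num)
  have hl21 : Real.log 2 ≤ 1 := by linarith [Real.log_two_lt_d9]
  refine ⟨d * C / Real.log 2 + 1, by positivity, ?_⟩
  intro u hsol x₀ R hR
  obtain ⟨hu, hub, heq, hst⟩ := hsol
  have hR0 : 0 < R := by linarith
  have hlog : 0 ≤ Real.log R := Real.log_nonneg hR
  have H : Sol d s c f f' α Cα u := ⟨hd, hs0, hs1, hc, hα, hder, hCα, hHol, hu, hub, heq, hst⟩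
  have hH := hHu u hu hub (fun x => by rw [heq x]; exact hfM _ (abs_le.mp (hub x)))
  have hdir : ∀ i : Fin d, ∫ x in ball x₀ R, |fderiv ℝ u x (EuclideanSpace.single i 1)| ≤
      C * (R ^ ((d:ℝ) + 2 * s) * ((R ^ 2)⁻¹ * (1 + Real.log R))) := by
    intro i
    have he : ‖(EuclideanSpace.single i 1 : Eu d)‖ = 1 := by simp
    refine dirbound hu hub he x₀ hR (B := C * R ^ ((d:ℝ) + 2 * s)) hβα fun h h0 h1 => ?_
    refine (hbd f f' u H hH (h • EuclideanSpace.single i 1) h h0 h1 ?_ x₀ R hR).trans (le_of_eq (by ring))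
    rw [norm_smul, he, mul_one, Real.norm_of_nonneg h0.le]
  have hfc : Continuous (fderiv ℝ u) := hu.continuous_fderiv (by norm_num)
  have hint : ∀ g : Eu d → ℝ, Continuous g → IntegrableOn g (ball x₀ R) := fun g hg =>
    (hg.continuousOn.integrableOn_compact (isCompact_closedBall x₀ R)).mono_set ball_subset_closedBall
  have hci : ∀ i : Fin d, Continuous (fun x => |fderiv ℝ u x (EuclideanSpace.single i 1)|) := fun i =>
    (hfc.clm_apply continuous_const).abs
  have hsum : (∫ x in ball x₀ R, ‖fderiv ℝ u x‖) ≤ d * (C * (R ^ ((d:ℝ) + 2 * s) * ((R ^ 2)⁻¹ * (1 + Real.log R)))) := by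
    calc (∫ x in ball x₀ R, ‖fderiv ℝ u x‖) ≤ ∫ x in ball x₀ R, ∑ i, |fderiv ℝ u x (EuclideanSpace.single i 1)| := by
          refine integral_mono (hint _ hfc.norm) (hint _ (continuous_finsetSum _ fun i _ => hci i)) fun x => ?_
          exact norm_le_sum _
      _ = ∑ i, ∫ x in ball x₀ R, |fderiv ℝ u x (EuclideanSpace.single i 1)| :=
          integral_finsetSum _ fun i _ => hint _ (hci i)
      _ ≤ ∑ i : Fin d, (C * (R ^ ((d:ℝ) + 2 * s) * ((R ^ 2)⁻¹ * (1 + Real.log R)))) := Finset.sum_le_sum fun i _ => hdir i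
      _ = _ := by simp
  refine hsum.trans ?_
  have hlogM : Real.log 2 * (1 + Real.log R) ≤ Real.log (M₀ * R) := by
    rw [Real.log_mul (by linarith) hR0.ne']
    have := Real.log_le_log (by norm_num) hM₀
    nlinarith
  have hpow : R ^ ((d:ℝ) + 2 * s) * (R ^ 2)⁻¹ = R ^ ((d:ℝ) + 2 * s - 2) := by
    rw [Real.rpow_sub hR0 _ 2, Real.rpow_two, div_eq_mul_inv]
  have hL0 : 0 ≤ Real.log (M₀ * R) := le_trans (by positivity) hlogM
  calc d * (C * (R ^ ((d:ℝ) + 2 * s) * ((R ^ 2)⁻¹ * (1 + Real.log R))))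
      = (d * C / Real.log 2) * (R ^ ((d:ℝ) + 2 * s) * (R ^ 2)⁻¹) * (Real.log 2 * (1 + Real.log R)) := by
        field_simp
    _ = (d * C / Real.log 2) * R ^ ((d:ℝ) + 2 * s - 2) * (Real.log 2 * (1 + Real.log R)) := by rw [hpow]
    _ ≤ (d * C / Real.log 2 + 1) * R ^ ((d:ℝ) + 2 * s - 2) * Real.log (M₀ * R) := by
        gcongr
        linarith
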